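/- arXiv:1607.03612 — 8 statements merged into one kernel-verified Lean document; each statement's English description precedes it below -/
import Mathlib

section
/- Let G be a finite cyclic group of order d ≥ 1 with generator φ. Then the element φ + φ^{-1} is a unit of the group ring ℤ_p[G] if and only if d ≢ 0 (mod 4). -/
/-- In a commutative ring where `2` is a unit, `1 + x` is a unit whenever `x` has an odd power
equal to `1`. -/
theorem isUnit_one_add_of_odd_pow_eq_one {R : Type*} [CommRing R] (h2 : IsUnit (2 : R)) {x : R}
    {m : ℕ} (hm : Odd m) (hx : x ^ m = 1) : IsUnit (1 + x) := by
  refine isUnit_of_dvd_unit ?_ h2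
  have h := hm.add_dvd_pow_add_pow 1 x
  rwa [hx, one_pow, one_add_one_eq_two] at h

/-- In a group ring, `1 + g` is not a unit when the order of `g` is even and positive. -/
theorem MonoidAlgebra.not_isUnit_one_add_of {R G : Type*} [CommRing R] [Nontrivial R]
    [CommGroup G] {g : G} (hpos : 0 < orderOf g) (heven : Even (orderOf g)) :
    ¬ IsUnit (1 + MonoidAlgebra.of R G g) := by
  classical
  intro hu
  set x := MonoidAlgebra.of R G g with hx
  have hgeom : (1 + x) * ∑ i ∈ Finset.range (orderOf g), (-x) ^ i = 0 := by
    have h := mul_neg_geom_sum (-x) (orderOf g)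
    rwa [heven.neg_pow, hx, ← map_pow, pow_orderOf_eq_one, map_one, sub_self, sub_neg_eq_add]
      at h
  have hcoeff := congrArg (fun f : MonoidAlgebra R G => f.coeff 1) (hu.mul_right_eq_zero.mp hgeom)
  have hterm (i : ℕ) (hi : i ∈ Finset.range (orderOf g)) :
      ((-x) ^ i).coeff 1 = if i = 0 then 1 else 0 := by
    have hsingle : (-x) ^ i = MonoidAlgebra.single (g ^ i) ((-1 : R) ^ i) := by
      rw [hx, MonoidAlgebra.of_apply, ← MonoidAlgebra.single_neg, MonoidAlgebra.single_pow]
    rw [hsingle, MonoidAlgebra.coeff_single, Finsupp.single_apply]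
    rcases eq_or_ne i 0 with rfl | h0
    · simp
    · rw [if_neg h0, if_neg (pow_ne_one_of_lt_orderOf h0 (Finset.mem_range.mp hi))]
  simp only [MonoidAlgebra.coeff_sum, Finsupp.finsetSum_apply] at hcoeff
  rw [Finset.sum_congr rfl hterm] at hcoeff
  simp [orderOf_pos_iff.mp hpos] at hcoeff

/-- Let `G` be a finite cyclic group of order `d ≥ 1` with generator `φ`. Then the element
`φ + φ⁻¹` is a unit of the group ring `ℤ_p[G]` if and only if `d ≢ 0 (mod 4)`. -/
theorem stmt0 (p : ℕ) [Fact p.Prime] (hp : Odd p)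
    (G : Type*) [CommGroup G] [Fintype G] (φ : G)
    (hgen : ∀ g : G, g ∈ Subgroup.zpowers φ)
    (d : ℕ) (hd : Fintype.card G = d) (hd1 : 1 ≤ d) :
    IsUnit (MonoidAlgebra.of ℤ_[p] G φ + MonoidAlgebra.of ℤ_[p] G φ⁻¹) ↔ ¬ (4 ∣ d) := by
  have hord : orderOf φ = d := by
    rw [orderOf_eq_card_of_forall_mem_zpowers hgen, Nat.card_eq_fintype_card, hd]
  have hfactor : MonoidAlgebra.of ℤ_[p] G φ + MonoidAlgebra.of ℤ_[p] G φ⁻¹ =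
      MonoidAlgebra.of ℤ_[p] G φ⁻¹ * (1 + MonoidAlgebra.of ℤ_[p] G (φ ^ 2)) := by
    rw [mul_add, mul_one, ← map_mul, pow_two, inv_mul_cancel_left, add_comm]
  have hinv : IsUnit (MonoidAlgebra.of ℤ_[p] G φ⁻¹) :=
    (Group.isUnit φ⁻¹).map (MonoidAlgebra.of ℤ_[p] G)
  rw [hfactor, IsUnit.mul_iff, and_iff_right hinv]
  constructor
  · rintro hu ⟨k, hk⟩
    have hsq : orderOf (φ ^ 2) = 2 * k := by
      rw [orderOf_pow_of_dvd two_ne_zero (by omega), hord]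
      omega
    exact MonoidAlgebra.not_isUnit_one_add_of (by omega) (hsq ▸ even_two_mul k) hu
  · intro h4
    have h2 : IsUnit (2 : ℤ_[p]) := by
      have hcop : p.Coprime 2 := Nat.coprime_two_right.mpr hp
      exact PadicInt.isUnit_iff.mpr (by exact_mod_cast PadicInt.norm_natCast_eq_one_iff.mpr hcop)
    obtain ⟨m, hm, hdvd⟩ : ∃ m, Odd m ∧ d ∣ 2 * m := by
      rcases Nat.even_or_odd d with ⟨m, hm⟩ | hodd
      · exact ⟨m, by rw [Nat.odd_iff]; omega, 1, by omega⟩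
      · exact ⟨d, hodd, dvd_mul_left d 2⟩
    have h2' := h2.map (algebraMap ℤ_[p] (MonoidAlgebra ℤ_[p] G))
    rw [map_ofNat] at h2'
    refine isUnit_one_add_of_odd_pow_eq_one h2' hm ?_
    rw [← map_pow, ← pow_mul, orderOf_dvd_iff_pow_eq_one.mp (hord ▸ hdvd), map_one]
end

section
/- Let G be a finite cyclic group of order d with generator φ and suppose d ≡ 0 (mod 4). Then the annihilator Ann_{ℤ_p[G]}(φ + φ^{-1}) = {x ∈ ℤ_p[G] : x·(φ + φ^{-1}) = 0} is a free ℤ_p-module of rank 2. -/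
/-- The sequence `a, b, -a, -b, a, b, …` with `u (n + 2) = -u n`. -/
def negTwoStep {R : Type*} [Neg R] (a b : R) : ℕ → R
  | 0 => a
  | 1 => b
  | n + 2 => -negTwoStep a b n

lemma negTwoStep_periodic {R : Type*} [InvolutiveNeg R] (a b : R) :
    Function.Periodic (negTwoStep a b) 4 := fun n ↦ by
  simp [negTwoStep]

lemma negTwoStep_congr {R : Type*} [InvolutiveNeg R] (a b : R) {m n : ℕ} (h : m ≡ n [MOD 4]) :
    negTwoStep a b m = negTwoStep a b n := by
  rw [← (negTwoStep_periodic a b).map_mod_nat m, ← (negTwoStep_periodic a b).map_mod_nat n, h]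

lemma MonoidAlgebra.mul_of_add_of_inv_eq_zero_iff {R G : Type*} [CommRing R] [CommGroup G]
    {φ : G} (hφ : ∀ g : G, ∃ n : ℕ, φ ^ n = g) (x : MonoidAlgebra R G) :
    x * (MonoidAlgebra.of R G φ + MonoidAlgebra.of R G φ⁻¹) = 0 ↔
      ∀ n : ℕ, x.coeff (φ ^ (n + 2)) = -x.coeff (φ ^ n) := by
  have key (g : G) : (x * (MonoidAlgebra.of R G φ + MonoidAlgebra.of R G φ⁻¹)).coeff (g * φ) =
      x.coeff g + x.coeff (g * φ ^ 2) := by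
    simp [mul_add, MonoidAlgebra.of_apply, pow_two, mul_assoc]
  constructor
  · intro h n
    have := key (φ ^ n)
    rw [h, ← pow_add] at this
    exact eq_neg_of_add_eq_zero_right this.symm
  · intro h
    ext g
    obtain ⟨n, hn⟩ := hφ (g * φ⁻¹)
    have := key (φ ^ n)
    rw [← pow_add, h, add_neg_cancel, hn, inv_mul_cancel_right] at this
    simpa using this

/-- An element annihilated by `φ + φ⁻¹` is determined by its coefficients at `1` and `φ`, which
are arbitrary. -/
lemma MonoidAlgebra.exists_ker_mulRight_of_add_of_inv_equiv {R G : Type*} [CommRing R]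
    [CommGroup G] [Finite G] {φ : G} (hφ : ∀ g : G, ∃ n : ℕ, φ ^ n = g) (h4 : 4 ∣ orderOf φ) :
    Nonempty (LinearMap.ker (LinearMap.mulRight R
      (MonoidAlgebra.of R G φ + MonoidAlgebra.of R G φ⁻¹)) ≃ₗ[R] R × R) := by
  let K := LinearMap.ker (LinearMap.mulRight R
      (MonoidAlgebra.of R G φ + MonoidAlgebra.of R G φ⁻¹))
  have hK (x : MonoidAlgebra R G) :
      x ∈ K ↔ ∀ n : ℕ, x.coeff (φ ^ (n + 2)) = -x.coeff (φ ^ n) :=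
    mul_of_add_of_inv_eq_zero_iff hφ x
  let F : K →ₗ[R] R × R :=
    { toFun := fun x ↦ (x.1.coeff 1, x.1.coeff φ)
      map_add' := fun x y ↦ by simp
      map_smul' := fun r x ↦ by simp }
  refine ⟨LinearEquiv.ofBijective F ⟨?_, ?_⟩⟩
  · rw [injective_iff_map_eq_zero]
    rintro ⟨x, hx⟩ h
    obtain ⟨h0, h1⟩ := Prod.mk.inj h
    rw [hK] at hx
    have hzero (n : ℕ) : x.coeff (φ ^ n) = 0 := by
      induction n using Nat.twoStepInduction with
      | zero => simpa using h0
      | one => simpa using h1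
      | more n ih _ => rw [hx, ih, neg_zero]
    ext g
    obtain ⟨n, rfl⟩ := hφ g
    simpa using hzero n
  · rintro ⟨a, b⟩
    choose l hl using hφ
    let x : MonoidAlgebra R G :=
      MonoidAlgebra.ofCoeff (Finsupp.equivFunOnFinite.symm fun g ↦ negTwoStep a b (l g))
    have hx (n : ℕ) : x.coeff (φ ^ n) = negTwoStep a b n :=
      negTwoStep_congr a b ((pow_eq_pow_iff_modEq.mp (hl (φ ^ n))).of_dvd h4)
    refine ⟨⟨x, (hK x).mpr fun n ↦ ?_⟩, Prod.ext ?_ ?_⟩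
    · rw [hx, hx, negTwoStep]
    · exact (congrArg x.coeff (pow_zero φ)).symm.trans (hx 0)
    · exact (congrArg x.coeff (pow_one φ)).symm.trans (hx 1)

/-- Let `G` be a finite cyclic group of order `d` with generator `φ` and `d ≡ 0 (mod 4)`.
Then the annihilator `Ann_{ℤ_p[G]}(φ + φ⁻¹) = {x ∈ ℤ_p[G] : x·(φ + φ⁻¹) = 0}` is a free
`ℤ_p`-module of rank `2`. -/
theorem stmt3 (p : ℕ) [Fact p.Prime] (hp : Odd p)
    (G : Type*) [CommGroup G] [Fintype G] (φ : G)
    (hgen : ∀ g : G, g ∈ Subgroup.zpowers φ)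
    (d : ℕ) (hd : Fintype.card G = d) (h4 : 4 ∣ d) :
    Module.Free ℤ_[p]
      (LinearMap.ker (LinearMap.mulRight ℤ_[p]
        (MonoidAlgebra.of ℤ_[p] G φ + MonoidAlgebra.of ℤ_[p] G φ⁻¹))) ∧
    Module.finrank ℤ_[p]
      (LinearMap.ker (LinearMap.mulRight ℤ_[p]
        (MonoidAlgebra.of ℤ_[p] G φ + MonoidAlgebra.of ℤ_[p] G φ⁻¹))) = 2 := by
  have hφ (g : G) : ∃ n : ℕ, φ ^ n = g :=
    Submonoid.mem_powers_iff _ _ |>.mp (mem_powers_iff_mem_zpowers.mpr (hgen g))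
  have h4' : 4 ∣ orderOf φ := by
    rwa [orderOf_eq_card_of_forall_mem_zpowers hgen, Nat.card_eq_fintype_card, hd]
  obtain ⟨e⟩ := MonoidAlgebra.exists_ker_mulRight_of_add_of_inv_equiv (R := ℤ_[p]) hφ h4'
  exact ⟨Module.Free.of_equiv e.symm, by rw [e.finrank_eq]; simp⟩
end

section
/- Let f : M → N be a surjective homomorphism of Λ-modules, where M is a finitely generated free Λ-module of Λ-rank r, and N is a Λ-module of Λ-rank s which has no nontrivial finite Λ-submodule. Then the kernel Ker f is a free Λ-module of Λ-rank r − s. -/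
open IsLocalRing in
/-- Let `(R, 𝔪)` be a Noetherian local ring whose maximal ideal is generated by `x` and `y`, such
that the first Koszul homology of `(x, y)` on `M` vanishes. If `f : M → N` and no nonzero element
of `N` is killed by both `x` and `y`, then `ker f` is free. -/
theorem LinearMap.free_ker_of_maximalIdeal_eq_span_pair
    {R M N : Type*} [CommRing R] [IsLocalRing R] [IsNoetherianRing R]
    [AddCommGroup M] [AddCommGroup N] [Module R M] [Module R N] [Module.Finite R M]
    (f : M →ₗ[R] N) {x y : R} (hxy : maximalIdeal R = Ideal.span {x, y})
    (hM : ∀ a b : M, x • a + y • b = 0 → ∃ c, a = y • c ∧ b = -(x • c))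
    (hN : ∀ n : N, x • n = 0 → y • n = 0 → n = 0) :
    Module.Free R (LinearMap.ker f) := by
  have := Module.finitePresentation_of_finite R (LinearMap.ker f)
  apply Module.free_of_maximalIdeal_rTensor_injective
  have hx : x ∈ maximalIdeal R := hxy ▸ Ideal.subset_span (by simp)
  have hy : y ∈ maximalIdeal R := hxy ▸ Ideal.subset_span (by simp)
  let x' : maximalIdeal R := ⟨x, hx⟩
  let y' : maximalIdeal R := ⟨y, hy⟩
  rw [injective_iff_map_eq_zero]
  intro t ht
  obtain ⟨k, l, rfl⟩ : ∃ k l : LinearMap.ker f, t = x' ⊗ₜ[R] k + y' ⊗ₜ[R] l := by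
    clear ht
    induction t with
    | zero => exact ⟨0, 0, by simp⟩
    | tmul a k =>
      obtain ⟨a, ha⟩ := a
      obtain ⟨u, v, rfl⟩ := Ideal.mem_span_pair.mp (hxy ▸ ha)
      refine ⟨u • k, v • k, ?_⟩
      rw [← TensorProduct.smul_tmul, ← TensorProduct.smul_tmul, ← TensorProduct.add_tmul]
      rfl
    | add s t hs ht =>
      obtain ⟨k, l, rfl⟩ := hs
      obtain ⟨k', l', rfl⟩ := ht
      refine ⟨k + k', l + l', ?_⟩
      rw [TensorProduct.tmul_add, TensorProduct.tmul_add]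
      abel
  have hkl : x • k + y • l = 0 := by
    simpa [x', y'] using congrArg (TensorProduct.lid R (LinearMap.ker f)) ht
  obtain ⟨c, hc, hc'⟩ := hM k l (by simpa using congrArg Subtype.val hkl)
  have hcK : f c = 0 := by
    apply hN
    · have := l.2
      rwa [hc', LinearMap.mem_ker, map_neg, neg_eq_zero, map_smul] at this
    · have := k.2
      rwa [hc, LinearMap.mem_ker, map_smul] at this
  let c' : LinearMap.ker f := ⟨c, hcK⟩
  obtain rfl : k = y • c' := Subtype.ext hc
  obtain rfl : l = -(x • c') := Subtype.ext hc'
  have hswap : y • x' = x • y' := Subtype.ext (mul_comm y x)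
  rw [TensorProduct.tmul_neg, ← TensorProduct.smul_tmul, ← TensorProduct.smul_tmul, hswap,
    add_neg_cancel]

/-- Vanishing of the first Koszul homology of `(x, y)` passes from a ring to its free modules. -/
theorem Module.Free.exists_of_smul_add_smul_eq_zero
    {R M : Type*} [CommRing R] [AddCommGroup M] [Module R M] [Module.Free R M] {x y : R}
    (hR : ∀ a b : R, x * a + y * b = 0 → ∃ c, a = y * c ∧ b = -(x * c))
    (a b : M) (hab : x • a + y • b = 0) : ∃ c, a = y • c ∧ b = -(x • c) := by
  let B := Module.Free.chooseBasis R M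
  have h (i) : ∃ c, B.repr a i = y * c ∧ B.repr b i = -(x * c) :=
    hR _ _ (by simpa using DFunLike.congr_fun (congrArg B.repr hab) i)
  choose c hc hc' using h
  classical
  let s := (B.repr a).support ∪ (B.repr b).support
  refine ⟨B.repr.symm (Finsupp.onFinset s (fun i ↦ if i ∈ s then c i else 0) (by simp_all)),
    B.repr.injective (Finsupp.ext fun i ↦ ?_), B.repr.injective (Finsupp.ext fun i ↦ ?_)⟩
  all_goals
    by_cases hi : i ∈ s
    · simp [hi, ← hc, ← hc']
    · simp only [map_neg, map_smul, LinearEquiv.apply_symm_apply, Finsupp.neg_apply,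
        Finsupp.smul_apply, Finsupp.onFinset_apply, hi, if_false, smul_zero, neg_zero]
      simp only [s, Finset.mem_union, Finsupp.mem_support_iff, not_or, not_not] at hi
      simp [hi]

namespace PowerSeries

theorem exists_of_C_mul_add_X_mul_eq_zero {A : Type*} [CommRing A] [IsDomain A] {x : A}
    (hx : x ≠ 0) (a b : A⟦X⟧) (hab : C x * a + X * b = 0) :
    ∃ c, a = X * c ∧ b = -(C x * c) := by
  obtain ⟨c, rfl⟩ : X ∣ a := by
    rw [X_dvd_iff]
    simpa [hx] using congrArg constantCoeff hab
  refine ⟨c, rfl, mul_left_cancel₀ (X_ne_zero (R := A)) ?_⟩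
  linear_combination hab

theorem exists_eq_C_add_X_mul {A : Type*} [CommRing A] (a : A⟦X⟧) :
    ∃ b, a = C (constantCoeff a) + X * b := by
  obtain ⟨b, hb⟩ : X ∣ a - C (constantCoeff a) := by simp [X_dvd_iff]
  exact ⟨b, by rw [← hb]; ring⟩

theorem maximalIdeal_padicInt_eq_span (p : ℕ) [Fact p.Prime] :
    IsLocalRing.maximalIdeal ℤ_[p]⟦X⟧ = Ideal.span {C (p : ℤ_[p]), X} := by
  have hp : ¬ IsUnit (p : ℤ_[p]) := PadicInt.p_nonunit
  apply le_antisymm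
  · intro a ha
    obtain ⟨b, hb⟩ := exists_eq_C_add_X_mul a
    have h0 : constantCoeff a ∈ IsLocalRing.maximalIdeal ℤ_[p] := by
      rwa [IsLocalRing.mem_maximalIdeal, mem_nonunits_iff, isUnit_iff_constantCoeff] at ha
    rw [PadicInt.maximalIdeal_eq_span_p, Ideal.mem_span_singleton] at h0
    obtain ⟨d, hd⟩ := h0
    rw [Ideal.mem_span_pair]
    exact ⟨C d, b, by rw [hb, hd, map_mul]; ring⟩
  · rw [Ideal.span_le, Set.insert_subset_iff, Set.singleton_subset_iff]
    simp [isUnit_iff_constantCoeff, hp]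

theorem finite_span_singleton_of_smul_eq_zero (p : ℕ) [Fact p.Prime] {N : Type*} [AddCommGroup N]
    [Module ℤ_[p]⟦X⟧ N] {n : N} (hpn : C (p : ℤ_[p]) • n = 0)
    (hXn : (X : ℤ_[p]⟦X⟧) • n = 0) :
    (Submodule.span ℤ_[p]⟦X⟧ {n} : Set N).Finite := by
  refine ((Set.finite_lt_nat p).image fun i ↦ i • n).subset fun m hm ↦ ?_
  obtain ⟨a, rfl⟩ := Submodule.mem_span_singleton.mp hm
  obtain ⟨b, hb⟩ := exists_eq_C_add_X_mul a
  obtain ⟨i, hi, hai⟩ := PadicInt.exists_mem_range (constantCoeff a)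
  rw [PadicInt.maximalIdeal_eq_span_p, Ideal.mem_span_singleton] at hai
  obtain ⟨d, hd⟩ := hai
  refine ⟨i, hi, ?_⟩
  have ha : a = (i : ℤ_[p]⟦X⟧) + C d * C (p : ℤ_[p]) + b * X := by
    rw [hb, sub_eq_iff_eq_add.mp hd]
    simp only [map_add, map_mul, map_natCast]
    ring
  simp only [ha, add_smul, mul_smul, hpn, hXn, smul_zero, add_zero, Nat.cast_smul_eq_nsmul]

end PowerSeries

theorem Module.finrank_localizedModule_nonZeroDivisors (R M : Type*) [CommRing R]
    [AddCommGroup M] [Module R M] :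
    Module.finrank (FractionRing R) (LocalizedModule (nonZeroDivisors R) M) =
      Module.finrank R M := by
  rw [IsFractionRing.finrank_right_eq R,
    IsLocalizedModule.finrank_eq _ (LocalizedModule.mkLinearMap (nonZeroDivisors R) M) le_rfl]

/-- Rank-nullity for a surjection of modules over a domain, in terms of the ranks over the
fraction field. -/
theorem LinearMap.finrank_localizedModule_ker {R M N : Type*} [CommRing R] [IsDomain R]
    [AddCommGroup M] [AddCommGroup N] [Module R M] [Module R N] [Module.Finite R M]
    (f : M →ₗ[R] N) (hf : Function.Surjective f) :
    Module.finrank (FractionRing R) (LocalizedModule (nonZeroDivisors R) (LinearMap.ker f)) =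
      Module.finrank (FractionRing R) (LocalizedModule (nonZeroDivisors R) M) -
        Module.finrank (FractionRing R) (LocalizedModule (nonZeroDivisors R) N) := by
  simp only [Module.finrank_localizedModule_nonZeroDivisors]
  rw [← (f.quotKerEquivOfSurjective hf).finrank_eq,
    ← (LinearMap.ker f).finrank_quotient_add_finrank, Nat.add_sub_cancel_left]

/-- Let `f : M → N` be a surjective homomorphism of `Λ`-modules (`Λ = ℤ_p[[X]]`), where `M`
is a finitely generated free `Λ`-module of `Λ`-rank `r`, and `N` is a `Λ`-module of `Λ`-rank
`s` which has no nontrivial finite `Λ`-submodule. Then `ker f` is a free `Λ`-module of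
`Λ`-rank `r − s`. Here the `Λ`-rank is `dim_{Frac(Λ)} (· ⊗_Λ Frac(Λ))`. -/
theorem stmt5 (p : ℕ) [Fact p.Prime]
    (M N : Type*) [AddCommGroup M] [AddCommGroup N]
    [Module (PowerSeries ℤ_[p]) M] [Module (PowerSeries ℤ_[p]) N]
    [Module.Finite (PowerSeries ℤ_[p]) M] [Module.Free (PowerSeries ℤ_[p]) M]
    (f : M →ₗ[PowerSeries ℤ_[p]] N) (hf : Function.Surjective f)
    (r s : ℕ)
    (hr : Module.finrank (FractionRing (PowerSeries ℤ_[p]))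
        (LocalizedModule (nonZeroDivisors (PowerSeries ℤ_[p])) M) = r)
    (hs : Module.finrank (FractionRing (PowerSeries ℤ_[p]))
        (LocalizedModule (nonZeroDivisors (PowerSeries ℤ_[p])) N) = s)
    (hN : ∀ P : Submodule (PowerSeries ℤ_[p]) N, (P : Set N).Finite → P = ⊥) :
    Module.Free (PowerSeries ℤ_[p]) (LinearMap.ker f) ∧
    Module.finrank (FractionRing (PowerSeries ℤ_[p]))
      (LocalizedModule (nonZeroDivisors (PowerSeries ℤ_[p])) (LinearMap.ker f)) = r - s := by
  refine ⟨?_, by rw [f.finrank_localizedModule_ker hf, hr, hs]⟩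
  have hp : (p : ℤ_[p]) ≠ 0 := by exact_mod_cast (Fact.out : p.Prime).ne_zero
  refine f.free_ker_of_maximalIdeal_eq_span_pair (PowerSeries.maximalIdeal_padicInt_eq_span p)
    (Module.Free.exists_of_smul_add_smul_eq_zero
      (PowerSeries.exists_of_C_mul_add_X_mul_eq_zero hp)) fun n hpn hXn ↦ ?_
  exact Submodule.span_singleton_eq_bot.mp
    (hN _ (PowerSeries.finite_span_singleton_of_smul_eq_zero p hpn hXn))
end

section
/- Let f : M → N be an injective homomorphism of Λ-modules. Suppose N is a finitely generated Λ-module which has no nontrivial finite Λ-submodule, and M is a finitely generated free Λ-module. Then the cokernel Coker f = N/f(M) has no nontrivial finite Λ-submodule. -/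
/-- An element of a finite submodule is killed by a power of any nonunit of a local ring. -/
theorem exists_pow_smul_eq_zero_of_finite {R V : Type*} [CommRing R] [IsLocalRing R]
    [AddCommGroup V] [Module R V] {P : Submodule R V} (hP : (P : Set V).Finite) {r : R}
    (hr : ¬ IsUnit r) {x : V} (hx : x ∈ P) : ∃ n : ℕ, r ^ n • x = 0 := by
  have hmem : ∀ n : ℕ, r ^ n • x ∈ (P : Set V) := fun n => P.smul_mem _ hx
  obtain ⟨i, -, j, -, hij, h⟩ := Set.infinite_univ.exists_lt_map_eq_of_mapsTo
    (f := fun n : ℕ => r ^ n • x) (fun n _ => hmem n) hP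
  refine ⟨i, ?_⟩
  have hu : IsUnit (1 - r ^ (j - i)) := by
    apply IsLocalRing.isUnit_one_sub_self_of_mem_nonunits
    intro hpow
    exact hr ((isUnit_pow_iff (by omega)).1 hpow)
  apply (hu.smul_eq_zero (x := r ^ i • x)).1
  have hpow : r ^ (j - i) • r ^ i • x = r ^ j • x := by
    rw [smul_smul, ← pow_add, Nat.sub_add_cancel hij.le]
  rw [sub_smul, one_smul, hpow, sub_eq_zero]
  exact h

/-- In a power series ring, `C r` divides whatever it divides after multiplication by `X ^ n`. -/
theorem PowerSeries.C_dvd_of_C_dvd_X_pow_mul {R : Type*} [CommRing R] {r : R} {n : ℕ}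
    {c : PowerSeries R} (h : PowerSeries.C r ∣ PowerSeries.X ^ n * c) : PowerSeries.C r ∣ c := by
  obtain ⟨d, hd⟩ := h
  refine ⟨PowerSeries.mk fun k => PowerSeries.coeff (k + n) d, ?_⟩
  ext k
  have hk := congrArg (PowerSeries.coeff (k + n)) hd
  rw [PowerSeries.coeff_X_pow_mul, PowerSeries.coeff_C_mul] at hk
  rw [PowerSeries.coeff_C_mul, PowerSeries.coeff_mk, hk]

/-- An element of a `ℤ_p[[X]]`-module killed by powers of `p` and of `X` spans a finite
submodule. -/
theorem PadicInt.finite_span_singleton_of_pow_smul_eq_zero {p : ℕ} [Fact p.Prime] {V : Type*}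
    [AddCommGroup V] [Module (PowerSeries ℤ_[p]) V] {z : V} {a b : ℕ}
    (ha : PowerSeries.C ((p : ℤ_[p]) ^ a) • z = 0)
    (hb : (PowerSeries.X : PowerSeries ℤ_[p]) ^ b • z = 0) :
    (Submodule.span (PowerSeries ℤ_[p]) {z} : Set V).Finite := by
  refine (Set.finite_range fun g : Fin b → Fin (p ^ a) =>
    (∑ i : Fin b, PowerSeries.X ^ (i : ℕ) * PowerSeries.C ((g i : ℕ) : ℤ_[p])) • z).subset ?_
  intro w hw
  obtain ⟨c, rfl⟩ := Submodule.mem_span_singleton.1 hw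
  refine ⟨fun i => ⟨(PowerSeries.coeff (i : ℕ) c).appr a, PadicInt.appr_lt _ _⟩, ?_⟩
  have hcoeff : ∀ x : ℤ_[p], PowerSeries.C ((x.appr a : ℕ) : ℤ_[p]) • z = PowerSeries.C x • z := by
    intro x
    obtain ⟨y, hy⟩ := Ideal.mem_span_singleton'.1 (PadicInt.appr_spec a x)
    rw [eq_comm, ← sub_eq_zero, ← sub_smul, ← map_sub, ← hy, map_mul, mul_smul, ha, smul_zero]
  have htail : PowerSeries.X ^ b ∣
      c - ∑ i : Fin b, PowerSeries.X ^ (i : ℕ) * PowerSeries.C (PowerSeries.coeff (i : ℕ) c) := by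
    rw [PowerSeries.X_pow_dvd_iff]
    intro m hm
    rw [Fin.sum_univ_eq_sum_range
      (fun i => PowerSeries.X ^ i * PowerSeries.C (PowerSeries.coeff i c)) b]
    simp [PowerSeries.coeff_X_pow, PowerSeries.coeff_mul_C, hm]
  obtain ⟨d, hd⟩ := htail
  have hc : c • z = (∑ i : Fin b,
      PowerSeries.X ^ (i : ℕ) * PowerSeries.C (PowerSeries.coeff (i : ℕ) c)) • z := by
    rw [← sub_eq_zero, ← sub_smul, hd, mul_comm, mul_smul, hb, smul_zero]
  rw [hc]
  simp only [Finset.sum_smul, mul_smul, hcoeff]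


/-- Let `f : M → N` be an injective homomorphism of `Λ`-modules (`Λ = ℤ_p[[X]]`). Suppose
`N` is a finitely generated `Λ`-module with no nontrivial finite `Λ`-submodule and `M` is a
finitely generated free `Λ`-module. Then `N/f(M)` has no nontrivial finite `Λ`-submodule. -/
theorem stmt6 (p : ℕ) [Fact p.Prime]
    (M N : Type*) [AddCommGroup M] [AddCommGroup N]
    [Module (PowerSeries ℤ_[p]) M] [Module (PowerSeries ℤ_[p]) N]
    [Module.Finite (PowerSeries ℤ_[p]) M] [Module.Free (PowerSeries ℤ_[p]) M]
    [Module.Finite (PowerSeries ℤ_[p]) N]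
    (f : M →ₗ[PowerSeries ℤ_[p]] N) (hf : Function.Injective f)
    (hN : ∀ P : Submodule (PowerSeries ℤ_[p]) N, (P : Set N).Finite → P = ⊥) :
    ∀ P : Submodule (PowerSeries ℤ_[p]) (N ⧸ LinearMap.range f),
      (P : Set (N ⧸ LinearMap.range f)).Finite → P = ⊥ := by
  intro P hP
  rw [eq_bot_iff]
  intro x hx
  rw [Submodule.mem_bot]
  have hp : ¬ IsUnit (PowerSeries.C (p : ℤ_[p])) := by
    rw [PowerSeries.isUnit_iff_constantCoeff, PowerSeries.constantCoeff_C]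
    exact PadicInt.prime_p.not_isUnit
  have hX : ¬ IsUnit (PowerSeries.X : PowerSeries ℤ_[p]) := by
    simp [PowerSeries.isUnit_iff_constantCoeff]
  obtain ⟨a, ha⟩ := exists_pow_smul_eq_zero_of_finite hP hp hx
  obtain ⟨b, hb⟩ := exists_pow_smul_eq_zero_of_finite hP hX hx
  obtain ⟨y, rfl⟩ := Submodule.Quotient.mk_surjective _ x
  rw [← map_pow] at ha
  rw [← Submodule.Quotient.mk_smul, Submodule.Quotient.mk_eq_zero] at ha hb
  obtain ⟨m₁, h₁⟩ := ha
  obtain ⟨m₂, h₂⟩ := hb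
  have hm : (PowerSeries.X : PowerSeries ℤ_[p]) ^ b • m₁ = PowerSeries.C ((p : ℤ_[p]) ^ a) • m₂ := by
    apply hf
    rw [map_smul, map_smul, h₁, h₂, smul_comm]
  let B := Module.Free.chooseBasis (PowerSeries ℤ_[p]) M
  have hdvd : ∀ i, PowerSeries.C ((p : ℤ_[p]) ^ a) ∣ B.equivFun m₁ i := by
    intro i
    apply PowerSeries.C_dvd_of_C_dvd_X_pow_mul (n := b)
    refine ⟨B.equivFun m₂ i, ?_⟩
    have := congrFun (congrArg B.equivFun hm) i
    simpa only [map_smul, Pi.smul_apply, smul_eq_mul] using this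
  choose e he using hdvd
  have hm₁ : m₁ = PowerSeries.C ((p : ℤ_[p]) ^ a) • B.equivFun.symm e := by
    apply B.equivFun.injective
    rw [map_smul, LinearEquiv.apply_symm_apply]
    exact funext he
  have hC : PowerSeries.C ((p : ℤ_[p]) ^ a) ≠ 0 := by
    rw [Ne, map_eq_zero_iff _ PowerSeries.C_injective]
    exact pow_ne_zero _ PadicInt.prime_p.ne_zero
  have hm₂ : m₂ = (PowerSeries.X : PowerSeries ℤ_[p]) ^ b • B.equivFun.symm e := by
    rw [hm₁, smul_comm] at hm
    apply B.equivFun.injective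
    funext i
    have := congrFun (congrArg B.equivFun hm) i
    rw [map_smul, map_smul _ _ m₂] at this
    exact (mul_left_cancel₀ hC this).symm
  have hz := hN _ (PadicInt.finite_span_singleton_of_pow_smul_eq_zero
    (z := y - f (B.equivFun.symm e)) (a := a) (b := b)
    (by rw [smul_sub, ← map_smul, ← hm₁, h₁, sub_self])
    (by rw [smul_sub, ← map_smul, ← hm₂, h₂, sub_self]))
  rw [Submodule.span_singleton_eq_bot, sub_eq_zero] at hz
  rw [Submodule.Quotient.mk_eq_zero, hz]
  exact LinearMap.mem_range_self _ _
end

section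
/- Let f : M → N be an injective homomorphism of finitely generated Λ-modules with finite cokernel. Suppose there is n₀ such that for all n ≥ n₀, the quotient M/ω_n M is a free ℤ_p-module and N_{Λ-tors} = { x ∈ N : ω_n x = 0 }. Then f induces an isomorphism of Λ-modules M/M_{Λ-tors} ≅ N/N_{Λ-tors}. -/
/-- A finite module over a local ring is killed by a power of the maximal ideal. -/
theorem IsLocalRing.exists_maximalIdeal_pow_smul_top_eq_bot (R C : Type*) [CommRing R]
    [IsLocalRing R] [AddCommGroup C] [Module R C] [Finite C] :
    ∃ k : ℕ, (IsLocalRing.maximalIdeal R ^ k • ⊤ : Submodule R C) = ⊥ := by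
  let F : ℕ →o (Submodule R C)ᵒᵈ :=
    ⟨fun k => OrderDual.toDual (IsLocalRing.maximalIdeal R ^ k • ⊤), fun _ _ h =>
      OrderDual.toDual_le_toDual.mpr (Submodule.smul_mono_left (Ideal.pow_le_pow_right h))⟩
  obtain ⟨k, hk⟩ := IsArtinian.monotone_stabilizes F
  have hstab : (IsLocalRing.maximalIdeal R ^ k • ⊤ : Submodule R C) =
      IsLocalRing.maximalIdeal R ^ (k + 1) • ⊤ := hk (k + 1) (Nat.le_succ k)
  refine ⟨k, Submodule.eq_bot_of_le_smul_of_le_jacobson_bot (IsLocalRing.maximalIdeal R) _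
    (IsNoetherian.noetherian _) ?_ (IsLocalRing.maximalIdeal_le_jacobson _)⟩
  rw [← Submodule.mul_smul, ← pow_succ']
  exact hstab.le

/-- If `x` and `p` lie in an ideal `I`, then `(1 + x) ^ p ^ n - 1` lies in `I ^ (n + 1)`. -/
theorem Ideal.one_add_pow_pow_sub_one_mem {R : Type*} [CommRing R] (I : Ideal R) {p : ℕ} {x : R}
    (hx : x ∈ I) (hp : (p : R) ∈ I) (n : ℕ) : (1 + x) ^ p ^ n - 1 ∈ I ^ (n + 1) := by
  induction n with
  | zero => simpa using hx
  | succ n ih =>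
    set y := (1 + x) ^ p ^ n with hy
    have hyI : y - 1 ∈ I := Ideal.pow_le_self (Nat.succ_ne_zero n) ih
    have hsum : ∑ i ∈ Finset.range p, y ^ i ∈ I := by
      rw [← Ideal.Quotient.eq_zero_iff_mem] at hyI hp ⊢
      have hy1 : Ideal.Quotient.mk I y = 1 := by simpa [sub_eq_zero] using hyI
      simpa [hy1] using hp
    rw [pow_succ p n, pow_mul, ← hy, ← geom_sum_mul, pow_succ' I]
    exact Ideal.mul_mem_mul hsum ih

/-- `(1 + X) ^ p ^ n - 1` kills any given finite `ℤ_p[[X]]`-module for all large `n`. -/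
theorem PowerSeries.exists_forall_one_add_X_pow_pow_sub_one_smul_eq_zero (p : ℕ) [Fact p.Prime]
    (C : Type*) [AddCommGroup C] [Module (PowerSeries ℤ_[p]) C] [Finite C] :
    ∃ k : ℕ, ∀ n ≥ k, ∀ c : C,
      ((1 + PowerSeries.X : PowerSeries ℤ_[p]) ^ p ^ n - 1) • c = 0 := by
  obtain ⟨k, hk⟩ :=
    IsLocalRing.exists_maximalIdeal_pow_smul_top_eq_bot (PowerSeries ℤ_[p]) C
  have hX : (PowerSeries.X : PowerSeries ℤ_[p]) ∈
      IsLocalRing.maximalIdeal (PowerSeries ℤ_[p]) := by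
    rw [IsLocalRing.mem_maximalIdeal, mem_nonunits_iff, PowerSeries.isUnit_iff_constantCoeff]
    simp
  have hp : (p : PowerSeries ℤ_[p]) ∈ IsLocalRing.maximalIdeal (PowerSeries ℤ_[p]) := by
    rw [IsLocalRing.mem_maximalIdeal, mem_nonunits_iff, PowerSeries.isUnit_iff_constantCoeff,
      map_natCast]
    exact PadicInt.p_nonunit
  refine ⟨k, fun n hn c => (Submodule.mem_bot (PowerSeries ℤ_[p])).mp (hk ▸ ?_)⟩
  exact Submodule.smul_mem_smul (Ideal.pow_le_pow_right (hn.trans n.le_succ)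
    (Ideal.one_add_pow_pow_sub_one_mem _ hX hp n)) Submodule.mem_top


/-- Let `f : M → N` be an injective homomorphism of finitely generated `Λ`-modules
(`Λ = ℤ_p[[X]]`) with finite cokernel. Suppose there is `n₀` such that for all `n ≥ n₀`
the quotient `M/ω_n M` is a free `ℤ_p`-module and `N_{Λ-tors} = {x ∈ N : ω_n x = 0}`,
where `ω_n = (1+X)^{p^n} − 1`. Then `f` induces an isomorphism of `Λ`-modules
`M/M_{Λ-tors} ≅ N/N_{Λ-tors}`. -/
theorem stmt7 (p : ℕ) [Fact p.Prime]
    (M N : Type*) [AddCommGroup M] [AddCommGroup N]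
    [Module (PowerSeries ℤ_[p]) M] [Module (PowerSeries ℤ_[p]) N]
    [Module.Finite (PowerSeries ℤ_[p]) M] [Module.Finite (PowerSeries ℤ_[p]) N]
    [Module ℤ_[p] M] [IsScalarTower ℤ_[p] (PowerSeries ℤ_[p]) M]
    (f : M →ₗ[PowerSeries ℤ_[p]] N) (hinj : Function.Injective f)
    (hcoker : Finite (N ⧸ LinearMap.range f))
    (n₀ : ℕ)
    (hfree : ∀ n ≥ n₀, Module.Free ℤ_[p]
      (M ⧸ (Ideal.span {(1 + PowerSeries.X : PowerSeries ℤ_[p]) ^ p ^ n - 1} • ⊤ :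
        Submodule (PowerSeries ℤ_[p]) M)))
    (htors : ∀ n ≥ n₀, Submodule.torsion (PowerSeries ℤ_[p]) N =
      Submodule.torsionBy (PowerSeries ℤ_[p]) N
        ((1 + PowerSeries.X : PowerSeries ℤ_[p]) ^ p ^ n - 1)) :
    Function.Bijective (Submodule.mapQ (Submodule.torsion (PowerSeries ℤ_[p]) M)
      (Submodule.torsion (PowerSeries ℤ_[p]) N) f
      (fun x hx => by
        obtain ⟨a, ha⟩ := hx
        exact Submodule.mem_comap.mpr ⟨a, by
          rw [Submonoid.smul_def] at ha ⊢
          rw [← map_smul, ha, map_zero]⟩)) := by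
  constructor
  · rw [← LinearMap.ker_eq_bot, LinearMap.ker_eq_bot']
    intro q hq
    obtain ⟨x, rfl⟩ := Submodule.Quotient.mk_surjective _ q
    rw [Submodule.mapQ_apply, Submodule.Quotient.mk_eq_zero] at hq
    rw [Submodule.Quotient.mk_eq_zero]
    obtain ⟨a, ha⟩ := hq
    refine ⟨a, hinj ?_⟩
    rw [Submonoid.smul_def] at ha ⊢
    rw [map_smul, ha, map_zero]
  · intro q
    obtain ⟨y, rfl⟩ := Submodule.Quotient.mk_surjective _ q
    obtain ⟨k, hk⟩ :=
      PowerSeries.exists_forall_one_add_X_pow_pow_sub_one_smul_eq_zero p (N ⧸ LinearMap.range f)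
    obtain ⟨n, hn₀, hnk⟩ : ∃ n, n ≥ n₀ ∧ n ≥ k := ⟨max n₀ k, le_max_left _ _, le_max_right _ _⟩
    have hω := hk n hnk (Submodule.Quotient.mk y)
    have := hfree n hn₀
    have htors_n := htors n hn₀
    clear hfree htors hk
    set ω := (1 + PowerSeries.X : PowerSeries ℤ_[p]) ^ p ^ n - 1
    rw [← Submodule.Quotient.mk_smul, Submodule.Quotient.mk_eq_zero] at hω
    obtain ⟨m, hm⟩ := hω
    have hc : Nat.card (N ⧸ LinearMap.range f) •
        (Submodule.Quotient.mk y : N ⧸ LinearMap.range f) = 0 := card_nsmul_eq_zero'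
    have hc0 : Nat.card (N ⧸ LinearMap.range f) ≠ 0 := Nat.card_pos.ne'
    generalize Nat.card (N ⧸ LinearMap.range f) = c at hc hc0
    rw [← Submodule.Quotient.mk_smul, Submodule.Quotient.mk_eq_zero] at hc
    obtain ⟨m', hm'⟩ := hc
    have hrel : c • m = ω • m' := hinj (by
      rw [map_nsmul, map_smul, hm, hm', smul_comm])
    have hzero : (c : ℤ_[p]) • (Submodule.Quotient.mk m :
        M ⧸ (Ideal.span {ω} • ⊤ : Submodule (PowerSeries ℤ_[p]) M)) = 0 := by
      rw [Nat.cast_smul_eq_nsmul, ← Submodule.Quotient.mk_smul, Submodule.Quotient.mk_eq_zero,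
        hrel]
      exact Submodule.smul_mem_smul (Ideal.mem_span_singleton_self ω) Submodule.mem_top
    have hmem := (smul_eq_zero.mp hzero).resolve_left (Nat.cast_ne_zero.mpr hc0)
    rw [Submodule.Quotient.mk_eq_zero, Submodule.ideal_span_singleton_smul,
      Submodule.mem_smul_pointwise_iff_exists] at hmem
    obtain ⟨m'', -, hm''⟩ := hmem
    refine ⟨Submodule.Quotient.mk m'', ?_⟩
    rw [Submodule.mapQ_apply, Submodule.Quotient.eq, htors_n, Submodule.mem_torsionBy_iff, smul_sub,
      ← map_smul, hm'', hm, sub_self]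
end

section
/- Let G be a finite cyclic group of order d with generator φ. Then the quotient ℤ_p[G]/(φ + φ^{-1})ℤ_p[G] is a free ℤ_p-module; it is zero if d ≢ 0 (mod 4), and it is of ℤ_p-rank 2 if d ≡ 0 (mod 4). -/
namespace CyclicGroupAlgebra

/-- The ideal `(φ + φ⁻¹) R[G]` of the group algebra of `G`. -/
noncomputable abbrev addInvIdeal (R : Type*) [CommRing R] {G : Type*} [CommGroup G] (φ : G) :
    Ideal (MonoidAlgebra R G) :=
  Ideal.span {MonoidAlgebra.of R G φ + MonoidAlgebra.of R G φ⁻¹}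

section

variable {R : Type*} [CommRing R] {G : Type*} [CommGroup G]

theorem mk_of_mul_self (φ : G) :
    Ideal.Quotient.mk (addInvIdeal R φ) (MonoidAlgebra.of R G φ) *
      Ideal.Quotient.mk (addInvIdeal R φ) (MonoidAlgebra.of R G φ) = -1 := by
  have hsum : Ideal.Quotient.mk (addInvIdeal R φ)
      (MonoidAlgebra.of R G φ + MonoidAlgebra.of R G φ⁻¹) = 0 :=
    Ideal.Quotient.eq_zero_iff_mem.2 (Ideal.mem_span_singleton_self _)
  have hinv : MonoidAlgebra.of R G φ * MonoidAlgebra.of R G φ⁻¹ = 1 := by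
    rw [← map_mul, mul_inv_cancel, map_one]
  have hinv' := congrArg (Ideal.Quotient.mk (addInvIdeal R φ)) hinv
  rw [map_mul, map_one] at hinv'
  rw [map_add] at hsum
  linear_combination Ideal.Quotient.mk (addInvIdeal R φ) (MonoidAlgebra.of R G φ) * hsum - hinv'

theorem subsingleton_quotient_addInvIdeal (h2 : IsUnit (2 : R)) (φ : G)
    (h4 : ¬ 4 ∣ orderOf φ) : Subsingleton (MonoidAlgebra R G ⧸ addInvIdeal R φ) := by
  set x := Ideal.Quotient.mk (addInvIdeal R φ) (MonoidAlgebra.of R G φ) with hx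
  have hsq : x ^ 2 = -1 := by rw [sq, hx, mk_of_mul_self]
  have hfour : x ^ 4 = 1 := by linear_combination (x ^ 2 - 1) * hsq
  have hord : x ^ orderOf φ = 1 := by
    rw [hx, ← map_pow, ← map_pow, pow_orderOf_eq_one, map_one, map_one]
  have hgcd : x ^ Nat.gcd 4 (orderOf φ) = 1 := pow_gcd_eq_one.2 ⟨hfour, hord⟩
  have hdvd : Nat.gcd 4 (orderOf φ) ∣ 2 := by
    have hle : Nat.gcd 4 (orderOf φ) ∣ 2 ^ 2 := Nat.gcd_dvd_left _ _
    obtain ⟨k, hk, hk'⟩ := (Nat.dvd_prime_pow Nat.prime_two).1 hle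
    have hne : k ≠ 2 := by
      rintro rfl
      exact h4 (Nat.gcd_eq_left_iff_dvd.1 hk')
    rw [hk']
    exact pow_dvd_pow 2 (by omega : k ≤ 1)
  have hone : x ^ 2 = 1 := by
    obtain ⟨m, hm⟩ := hdvd
    rw [hm, pow_mul, hgcd, one_pow]
  have htwo : (2 : MonoidAlgebra R G ⧸ addInvIdeal R φ) = 0 := by
    linear_combination hsq - hone
  have hunit := h2.map (algebraMap R (MonoidAlgebra R G ⧸ addInvIdeal R φ))
  rw [map_ofNat, htwo] at hunit
  exact subsingleton_of_zero_eq_one (isUnit_zero_iff.1 hunit)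

/-- The element `ω` of `R[ω]`, `ω² = -1`, as a unit. -/
def omegaUnit (R : Type*) [CommRing R] : (QuadraticAlgebra R (-1) 0)ˣ where
  val := QuadraticAlgebra.omega
  inv := -QuadraticAlgebra.omega
  val_inv := by ext <;> simp [QuadraticAlgebra.re_one, QuadraticAlgebra.im_one]
  inv_val := by ext <;> simp [QuadraticAlgebra.re_one, QuadraticAlgebra.im_one]

theorem orderOf_omegaUnit_dvd : orderOf (omegaUnit R) ∣ 4 := by
  apply orderOf_dvd_of_pow_eq_one
  ext <;> simp [omegaUnit, pow_succ, QuadraticAlgebra.re_one, QuadraticAlgebra.im_one]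

/-- When `4` divides the order of a generator `φ`, the map `R[G] → R[ω]`, `φ ↦ ω`. -/
noncomputable def toQuadraticAlgebra {φ : G} (hgen : ∀ g : G, g ∈ Subgroup.zpowers φ)
    (h4 : 4 ∣ orderOf φ) : MonoidAlgebra R G →ₐ[R] QuadraticAlgebra R (-1) 0 :=
  MonoidAlgebra.lift R _ G ((Units.coeHom _).comp
    (monoidHomOfForallMemZpowers hgen ((orderOf_omegaUnit_dvd (R := R)).trans h4)))

theorem toQuadraticAlgebra_of {φ : G} (hgen : ∀ g : G, g ∈ Subgroup.zpowers φ)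
    (h4 : 4 ∣ orderOf φ) :
    toQuadraticAlgebra (R := R) hgen h4 (MonoidAlgebra.of R G φ) = QuadraticAlgebra.omega := by
  rw [toQuadraticAlgebra, MonoidAlgebra.lift_of, MonoidHom.comp_apply,
    monoidHomOfForallMemZpowers_apply_gen]
  rfl

theorem toQuadraticAlgebra_of_inv {φ : G} (hgen : ∀ g : G, g ∈ Subgroup.zpowers φ)
    (h4 : 4 ∣ orderOf φ) :
    toQuadraticAlgebra (R := R) hgen h4 (MonoidAlgebra.of R G φ⁻¹) =
      -QuadraticAlgebra.omega := by
  rw [toQuadraticAlgebra, MonoidAlgebra.lift_of, MonoidHom.comp_apply, map_inv,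
    monoidHomOfForallMemZpowers_apply_gen]
  rfl

theorem algHom_ext_of_generator {A : Type*} [Semiring A] [Algebra R A] {φ : G}
    (hgen : ∀ g : G, g ∈ Subgroup.zpowers φ) {f₁ f₂ : MonoidAlgebra R G →ₐ[R] A}
    (h : f₁ (MonoidAlgebra.of R G φ) = f₂ (MonoidAlgebra.of R G φ)) : f₁ = f₂ := by
  have hle : Subgroup.zpowers φ ≤ MonoidHom.eqLocus
      ((f₁ : MonoidAlgebra R G →* A).comp (MonoidAlgebra.of R G))
      ((f₂ : MonoidAlgebra R G →* A).comp (MonoidAlgebra.of R G)) :=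
    Subgroup.zpowers_le.2 h
  refine MonoidAlgebra.algHom_ext (fun g => hle (hgen g)) ?_
  ext

/-- The map `R[ω] → R[G] / (φ + φ⁻¹)`, `ω ↦ φ`. -/
noncomputable def ofQuadraticAlgebra (φ : G) :
    QuadraticAlgebra R (-1) 0 →ₐ[R] MonoidAlgebra R G ⧸ addInvIdeal R φ :=
  QuadraticAlgebra.lift ⟨Ideal.Quotient.mk (addInvIdeal R φ) (MonoidAlgebra.of R G φ), by
    rw [mk_of_mul_self, zero_smul, add_zero, neg_smul, one_smul]⟩

theorem ofQuadraticAlgebra_omega (φ : G) :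
    ofQuadraticAlgebra (R := R) φ QuadraticAlgebra.omega =
      Ideal.Quotient.mk (addInvIdeal R φ) (MonoidAlgebra.of R G φ) := by
  rw [ofQuadraticAlgebra, QuadraticAlgebra.lift_apply_apply, QuadraticAlgebra.omega_re,
    QuadraticAlgebra.omega_im, zero_smul, zero_add, one_smul]

theorem addInvIdeal_le_ker_toQuadraticAlgebra {φ : G}
    (hgen : ∀ g : G, g ∈ Subgroup.zpowers φ) (h4 : 4 ∣ orderOf φ) :
    addInvIdeal R φ ≤ RingHom.ker (toQuadraticAlgebra (R := R) hgen h4) := by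
  rw [Ideal.span_singleton_le_iff_mem, RingHom.mem_ker, map_add, toQuadraticAlgebra_of,
    toQuadraticAlgebra_of_inv, add_neg_cancel]

/-- When `4` divides the order of a generator `φ`, the quotient `R[G] / (φ + φ⁻¹)` is `R[ω]`
with `ω² = -1`. -/
noncomputable def quotientEquivQuadraticAlgebra {φ : G}
    (hgen : ∀ g : G, g ∈ Subgroup.zpowers φ) (h4 : 4 ∣ orderOf φ) :
    (MonoidAlgebra R G ⧸ addInvIdeal R φ) ≃ₐ[R] QuadraticAlgebra R (-1) 0 :=
  AlgEquiv.ofAlgHom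
    (Ideal.Quotient.liftₐ (addInvIdeal R φ) (toQuadraticAlgebra hgen h4) fun _ ha =>
      RingHom.mem_ker.1 (addInvIdeal_le_ker_toQuadraticAlgebra hgen h4 ha))
    (ofQuadraticAlgebra φ)
    (by
      apply QuadraticAlgebra.algHom_ext
      rw [AlgHom.comp_apply, ofQuadraticAlgebra_omega]
      exact toQuadraticAlgebra_of hgen h4)
    (by
      apply Ideal.Quotient.algHom_ext
      apply algHom_ext_of_generator hgen
      change ofQuadraticAlgebra φ (toQuadraticAlgebra hgen h4 (MonoidAlgebra.of R G φ)) =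
        Ideal.Quotient.mk (addInvIdeal R φ) (MonoidAlgebra.of R G φ)
      rw [toQuadraticAlgebra_of, ofQuadraticAlgebra_omega])

end

end CyclicGroupAlgebra


/-- Let `G` be a finite cyclic group of order `d` with generator `φ`. Then the quotient
`ℤ_p[G]/(φ + φ⁻¹)ℤ_p[G]` is a free `ℤ_p`-module; it is zero if `d ≢ 0 (mod 4)`, and of
`ℤ_p`-rank `2` if `d ≡ 0 (mod 4)`. -/
theorem stmt13 (p : ℕ) [Fact p.Prime] (hp : Odd p)
    (G : Type*) [CommGroup G] [Fintype G] (φ : G)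
    (hgen : ∀ g : G, g ∈ Subgroup.zpowers φ)
    (d : ℕ) (hd : Fintype.card G = d) (hd1 : 1 ≤ d) :
    Module.Free ℤ_[p]
      (MonoidAlgebra ℤ_[p] G ⧸
        (Ideal.span {MonoidAlgebra.of ℤ_[p] G φ + MonoidAlgebra.of ℤ_[p] G φ⁻¹} :
          Ideal (MonoidAlgebra ℤ_[p] G))) ∧
    (¬ (4 ∣ d) →
      Subsingleton (MonoidAlgebra ℤ_[p] G ⧸
        (Ideal.span {MonoidAlgebra.of ℤ_[p] G φ + MonoidAlgebra.of ℤ_[p] G φ⁻¹} :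
          Ideal (MonoidAlgebra ℤ_[p] G)))) ∧
    ((4 ∣ d) →
      Module.finrank ℤ_[p] (MonoidAlgebra ℤ_[p] G ⧸
        (Ideal.span {MonoidAlgebra.of ℤ_[p] G φ + MonoidAlgebra.of ℤ_[p] G φ⁻¹} :
          Ideal (MonoidAlgebra ℤ_[p] G))) = 2) := by
  have hord : orderOf φ = d := by
    rw [orderOf_eq_card_of_forall_mem_zpowers hgen, Nat.card_eq_fintype_card, hd]
  have h2 : IsUnit (2 : ℤ_[p]) := by
    rw [PadicInt.isUnit_iff]
    have h := PadicInt.norm_natCast_eq_one_iff (p := p) (n := 2)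
    exact_mod_cast h.2 (Nat.coprime_two_right.2 hp)
  have hsub (h4 : ¬ 4 ∣ d) := CyclicGroupAlgebra.subsingleton_quotient_addInvIdeal h2 φ
    (hord ▸ h4)
  have e (h4 : 4 ∣ d) := CyclicGroupAlgebra.quotientEquivQuadraticAlgebra (R := ℤ_[p]) hgen
    (hord ▸ h4)
  refine ⟨?_, hsub, fun h4 => ?_⟩
  · by_cases h4 : 4 ∣ d
    · exact Module.Free.of_equiv (e h4).symm.toLinearEquiv
    · have := hsub h4
      exact Module.Free.of_subsingleton _ _
  · rw [(e h4).toLinearEquiv.finrank_eq, QuadraticAlgebra.finrank_eq_two]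
end

section
/- Let d ≥ 0 be an integer and δ ∈ {0, 2}. Let M be a finitely generated Λ-module such that for every n ≥ 0, the quotient M/ω_n M is a free ℤ_p-module of rank d·p^n + δ. Then there exists an injective homomorphism of Λ-modules M → Λ^{⊕ d} ⊕ (Λ/XΛ)^{⊕ δ} with finite cokernel. -/
section

open PowerSeries

section Quotients
variable {p : ℕ} [Fact p.Prime]

theorem Polynomial.IsDistinguishedAt.powerSeries_quotient {g : Polynomial ℤ_[p]}
    (hg : g.IsDistinguishedAt (IsLocalRing.maximalIdeal ℤ_[p])) :
    Module.Free ℤ_[p] (ℤ_[p]⟦X⟧ ⧸ Ideal.span {(g : ℤ_[p]⟦X⟧)}) ∧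
    Module.Finite ℤ_[p] (ℤ_[p]⟦X⟧ ⧸ Ideal.span {(g : ℤ_[p]⟦X⟧)}) ∧
    Module.finrank ℤ_[p] (ℤ_[p]⟦X⟧ ⧸ Ideal.span {(g : ℤ_[p]⟦X⟧)}) = g.natDegree := by
  have e := hg.algEquivQuotient.toLinearEquiv
  have := hg.monic.free_quotient
  have := hg.monic.finite_quotient
  exact ⟨.of_equiv e, .equiv e,
    e.finrank_eq.symm.trans (finrank_quotient_span_eq_natDegree' hg.monic)⟩

/-- For a module killed by `g`, the linear combination map out of a power of `R ⧸ (g)`. -/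
noncomputable def quotientSpanCombination {R N ι : Type*} [CommRing R] [AddCommGroup N] [Module R N]
    [Fintype ι] [DecidableEq ι] {g : R} (hg : ∀ x : N, g • x = 0) (v : ι → N) :
    (ι → R ⧸ Ideal.span {g}) →ₗ[R] N :=
  LinearMap.lsum R (fun _ ↦ R ⧸ Ideal.span {g}) R fun i ↦
    Submodule.liftQ _ (LinearMap.toSpanSingleton R N (v i)) <| by
      rw [Ideal.span, Submodule.span_le]
      simp [hg]

theorem quotientSpanCombination_mk {R N ι : Type*} [CommRing R] [AddCommGroup N] [Module R N]
    [Fintype ι] [DecidableEq ι] {g : R} (hg : ∀ x : N, g • x = 0) (v : ι → N) (a : ι → R) :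
    quotientSpanCombination hg v (fun i ↦ Submodule.Quotient.mk (a i)) = ∑ i, a i • v i := by
  simp only [quotientSpanCombination, LinearMap.lsum_apply, LinearMap.sum_apply,
    LinearMap.comp_apply, LinearMap.proj_apply, Submodule.liftQ_apply,
    LinearMap.toSpanSingleton_apply]

theorem quotientSpanCombination_surjective {R N ι : Type*} [CommRing R] [AddCommGroup N]
    [Module R N] [Fintype ι] [DecidableEq ι] {g : R} (hg : ∀ x : N, g • x = 0) {v : ι → N}
    (hv : Submodule.span R (Set.range v) = ⊤) :
    Function.Surjective (quotientSpanCombination hg v) := fun x ↦ by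
  obtain ⟨a, rfl⟩ := (Submodule.mem_span_range_iff_exists_fun R).1 (hv ▸ Submodule.mem_top : x ∈ _)
  exact ⟨_, quotientSpanCombination_mk hg v a⟩

variable {N : Type*} [AddCommGroup N] [Module ℤ_[p]⟦X⟧ N] [Module ℤ_[p] N]
  [IsScalarTower ℤ_[p] ℤ_[p]⟦X⟧ N]

theorem Polynomial.IsDistinguishedAt.module_finite {g : Polynomial ℤ_[p]}
    (hg : g.IsDistinguishedAt (IsLocalRing.maximalIdeal ℤ_[p])) [Module.Finite ℤ_[p]⟦X⟧ N]
    (hN : ∀ x : N, (g : ℤ_[p]⟦X⟧) • x = 0) : Module.Finite ℤ_[p] N := by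
  obtain ⟨k, v, hv⟩ := Module.Finite.exists_fin (R := ℤ_[p]⟦X⟧) (M := N)
  have := hg.powerSeries_quotient.2.1
  exact .of_surjective ((quotientSpanCombination hN v).restrictScalars ℤ_[p])
    (quotientSpanCombination_surjective hN hv)

theorem Polynomial.IsDistinguishedAt.mem_span_of_sum_smul_eq_zero {g : Polynomial ℤ_[p]}
    (hg : g.IsDistinguishedAt (IsLocalRing.maximalIdeal ℤ_[p]))
    [Module.Free ℤ_[p] N] [Module.Finite ℤ_[p] N]
    (hN : ∀ x : N, (g : ℤ_[p]⟦X⟧) • x = 0) {d : ℕ}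
    (hr : Module.finrank ℤ_[p] N = d * g.natDegree) {v : Fin d → N}
    (hv : Submodule.span ℤ_[p]⟦X⟧ (Set.range v) = ⊤) {a : Fin d → ℤ_[p]⟦X⟧}
    (ha : ∑ i, a i • v i = 0) (i : Fin d) : a i ∈ Ideal.span {(g : ℤ_[p]⟦X⟧)} := by
  obtain ⟨_, _, h⟩ := hg.powerSeries_quotient
  have hr' : Module.finrank ℤ_[p] (Fin d → ℤ_[p]⟦X⟧ ⧸ Ideal.span {(g : ℤ_[p]⟦X⟧)}) =
      Module.finrank ℤ_[p] N := by
    rw [Module.finrank_pi_fintype, hr]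
    simp [h]
  have hinj := OrzechProperty.injective_of_surjective_of_injective
    (LinearEquiv.ofFinrankEq _ _ hr').toLinearMap
    ((quotientSpanCombination hN v).restrictScalars ℤ_[p])
    (LinearEquiv.injective _) (quotientSpanCombination_surjective hN hv)
  have h0 := hinj (a₁ := fun i ↦ Submodule.Quotient.mk (a i)) (a₂ := 0) <| by
    simpa using (quotientSpanCombination_mk hN v a).trans ha
  exact (Submodule.Quotient.mk_eq_zero _).1 (congrFun h0 i)

end Quotients

section Omega
variable (p : ℕ) [Fact p.Prime]

/-- The polynomial `((1 + X) ^ p ^ n - 1) / X`. -/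
noncomputable def nuPoly (n : ℕ) : Polynomial ℤ_[p] :=
  (∑ i ∈ Finset.range (p ^ n), Polynomial.X ^ i).comp (Polynomial.X + 1)

theorem nuPoly_mul_X (n : ℕ) :
    (nuPoly p n : ℤ_[p]⟦X⟧) * X = (1 + X : ℤ_[p]⟦X⟧) ^ p ^ n - 1 := by
  have h : nuPoly p n * Polynomial.X = (1 + Polynomial.X) ^ p ^ n - 1 := by
    have := congrArg (·.comp (Polynomial.X + 1))
      (geom_sum_mul (Polynomial.X : Polynomial ℤ_[p]) (p ^ n))
    simpa [nuPoly, add_comm] using this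
  simpa using congrArg (fun q : Polynomial ℤ_[p] ↦ (q : ℤ_[p]⟦X⟧)) h

theorem coeff_nuPoly (n i : ℕ) : (nuPoly p n).coeff i = ((p ^ n).choose (i + 1) : ℤ_[p]) := by
  rw [nuPoly, Polynomial.geom_sum_X_comp_X_add_one_eq_sum]
  simp only [Polynomial.finsetSum_coeff, Polynomial.coeff_natCast_mul, Polynomial.coeff_X_pow,
    mul_ite, mul_one, mul_zero, Finset.sum_ite_eq, Finset.mem_range, ite_eq_left_iff, not_lt]
  intro h
  rw [Nat.choose_eq_zero_of_lt (by omega), Nat.cast_zero]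

theorem natDegree_nuPoly (n : ℕ) : (nuPoly p n).natDegree = p ^ n - 1 := by
  have hp := Nat.one_le_pow n _ (Fact.out : p.Prime).pos
  refine Polynomial.natDegree_eq_of_le_of_coeff_ne_zero ?_ ?_
  · refine Polynomial.natDegree_le_iff_coeff_eq_zero.2 fun i hi ↦ ?_
    rw [coeff_nuPoly, Nat.choose_eq_zero_of_lt (by omega), Nat.cast_zero]
  · rw [coeff_nuPoly, Nat.sub_add_cancel hp]
    simp

theorem nuPoly_isDistinguishedAt (n : ℕ) :
    (nuPoly p n).IsDistinguishedAt (IsLocalRing.maximalIdeal ℤ_[p]) where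
  monic := by
    rw [Polynomial.Monic, Polynomial.leadingCoeff, natDegree_nuPoly, coeff_nuPoly,
      Nat.sub_add_cancel (Nat.one_le_pow _ _ (Fact.out : p.Prime).pos)]
    simp
  mem {i} hi := by
    rw [natDegree_nuPoly] at hi
    rw [coeff_nuPoly, PadicInt.maximalIdeal_eq_span_p, Ideal.mem_span_singleton]
    exact_mod_cast Nat.cast_dvd_cast
      ((Fact.out : p.Prime).dvd_choose_pow (by omega) (by omega))

theorem mem_maximalIdeal_powerSeries_padicInt {a : ℤ_[p]⟦X⟧} :
    a ∈ IsLocalRing.maximalIdeal ℤ_[p]⟦X⟧ ↔ (p : ℤ_[p]) ∣ constantCoeff a := by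
  rw [← Ideal.mem_span_singleton, ← PadicInt.maximalIdeal_eq_span_p, IsLocalRing.mem_maximalIdeal,
    IsLocalRing.mem_maximalIdeal, mem_nonunits_iff, mem_nonunits_iff, isUnit_iff_constantCoeff]

theorem maximalIdeal_powerSeries_padicInt :
    IsLocalRing.maximalIdeal ℤ_[p]⟦X⟧ = Ideal.span {X, (p : ℤ_[p]⟦X⟧)} := by
  ext a
  rw [mem_maximalIdeal_powerSeries_padicInt, Ideal.mem_span_pair]
  constructor
  · rintro ⟨b, hb⟩
    refine ⟨mk fun i ↦ coeff (i + 1) a, C b, ?_⟩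
    rw [eq_comm, ← sub_eq_iff_eq_add, ← sub_const_eq_shift_mul_X, hb, map_mul, map_natCast,
      mul_comm]
  · rintro ⟨b, c, rfl⟩
    simp

theorem omega_mem_maximalIdeal_pow (n : ℕ) :
    (1 + X : ℤ_[p]⟦X⟧) ^ p ^ n - 1 ∈ IsLocalRing.maximalIdeal ℤ_[p]⟦X⟧ ^ n := by
  induction n with
  | zero => simp
  | succ n ih =>
    rw [pow_succ p, pow_mul, ← geom_sum_mul, pow_succ']
    refine Ideal.mul_mem_mul ((mem_maximalIdeal_powerSeries_padicInt p).2 ?_) ih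
    simp

theorem eq_zero_of_forall_mem_span_nuPoly {a : ℤ_[p]⟦X⟧}
    (ha : ∀ n, a ∈ Ideal.span {(nuPoly p n : ℤ_[p]⟦X⟧)}) : a = 0 := by
  have h : a * X ∈ ⨅ n, IsLocalRing.maximalIdeal ℤ_[p]⟦X⟧ ^ n := by
    rw [Ideal.mem_iInf]
    intro n
    obtain ⟨b, rfl⟩ := Ideal.mem_span_singleton.1 (ha n)
    rw [mul_right_comm, nuPoly_mul_X]
    exact Ideal.mul_mem_right _ _ (omega_mem_maximalIdeal_pow p n)
  rw [Ideal.iInf_pow_eq_bot_of_isLocalRing _ Ideal.IsPrime.ne_top'] at h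
  simpa [X_ne_zero] using h

theorem exists_nuPoly_one_eq :
    ∃ w : ℤ_[p]⟦X⟧ˣ, (nuPoly p 1 : ℤ_[p]⟦X⟧) = X ^ (p - 1) + (p : ℤ_[p]⟦X⟧) * (w : ℤ_[p]⟦X⟧) := by
  have hp := (Fact.out : p.Prime).two_le
  have h : Polynomial.C (p : ℤ_[p]) ∣ nuPoly p 1 - Polynomial.X ^ (p - 1) := by
    refine Polynomial.C_dvd_iff_dvd_coeff _ _ |>.2 fun i ↦ ?_
    rw [Polynomial.coeff_sub, coeff_nuPoly, Polynomial.coeff_X_pow, pow_one]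
    split_ifs with hi
    · simp [hi, Nat.sub_add_cancel (by omega : 1 ≤ p)]
    · rw [sub_zero]
      rcases lt_or_ge (i + 1) p with h | h
      · exact Nat.cast_dvd_cast ((Fact.out : p.Prime).dvd_choose_self (by omega) h)
      · rw [Nat.choose_eq_zero_of_lt (by omega), Nat.cast_zero]
        exact dvd_zero _
  obtain ⟨w, hw⟩ := h
  have h0 := congrArg (Polynomial.coeff · 0) hw
  simp only [Polynomial.coeff_sub, coeff_nuPoly, Polynomial.coeff_X_pow, pow_one, zero_add,
    Nat.choose_one_right, Polynomial.coeff_C_mul, if_neg (by omega : ¬ 0 = p - 1), sub_zero] at h0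
  have hw0 : w.coeff 0 = 1 :=
    (mul_right_injective₀ (Nat.cast_ne_zero.2 (by omega : p ≠ 0)) (h0.symm.trans (mul_one _).symm))
  have hu : IsUnit (w : ℤ_[p]⟦X⟧) := by
    rw [isUnit_iff_constantCoeff]
    simp [hw0]
  refine ⟨hu.unit, ?_⟩
  rw [sub_eq_iff_eq_add'.1 hw, Polynomial.coe_add, Polynomial.coe_pow, Polynomial.coe_X,
    Polynomial.coe_mul, Polynomial.coe_C, map_natCast, IsUnit.unit_spec]

end Omega

section Generators

theorem index_range_pow_smul {R A : Type*} [CommRing R] [AddCommGroup A] [Module R A] {x : R}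
    (hx : Function.Injective (x • · : A → A)) (k : ℕ) :
    (DistribSMul.toAddMonoidHom A (x ^ k)).range.index =
      (DistribSMul.toAddMonoidHom A x).range.index ^ k := by
  induction k with
  | zero =>
    rw [pow_zero, pow_zero, AddSubgroup.index_eq_one, AddMonoidHom.range_eq_top]
    exact fun y ↦ ⟨y, by simp⟩
  | succ k ih =>
    have h : (DistribSMul.toAddMonoidHom A (x ^ (k + 1))).range =
        (DistribSMul.toAddMonoidHom A (x ^ k)).range.map (DistribSMul.toAddMonoidHom A x) := by
      rw [AddMonoidHom.map_range]
      congr 1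
      ext y
      simp [pow_succ', mul_smul]
    rw [h, AddSubgroup.index_map_of_injective _ hx, ih, pow_succ]

variable {p : ℕ} [Fact p.Prime]

theorem PadicInt.index_range_prime_smul (B : Type*) [AddCommGroup B] [Module ℤ_[p] B]
    [Module.Free ℤ_[p] B] [Module.Finite ℤ_[p] B] :
    (DistribSMul.toAddMonoidHom B (p : ℤ_[p])).range.index = p ^ Module.finrank ℤ_[p] B := by
  let b := Module.finBasis ℤ_[p] B
  let f : B →+ (Fin (Module.finrank ℤ_[p] B) → ZMod p) :=
    (AddMonoidHom.pi fun i ↦ (PadicInt.toZMod (p := p)).toAddMonoidHom.comp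
      (Pi.evalAddMonoidHom _ i)).comp b.equivFun.toLinearMap.toAddMonoidHom
  have hf (x : B) (i) : f x i = PadicInt.toZMod (b.equivFun x i) := rfl
  have hs : Function.Surjective f := fun y ↦ by
    choose z hz using fun i ↦ ZMod.ringHom_surjective (PadicInt.toZMod (p := p)) (y i)
    exact ⟨b.equivFun.symm z, funext fun i ↦ by rw [hf, LinearEquiv.apply_symm_apply, hz]⟩
  have hk : (DistribSMul.toAddMonoidHom B (p : ℤ_[p])).range = f.ker := by
    ext x
    rw [AddMonoidHom.mem_ker]
    constructor
    · rintro ⟨y, rfl⟩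
      ext i
      simp [hf]
    · intro hx
      have h (i) : ∃ c, b.equivFun x i = p * c := by
        have : b.equivFun x i ∈ RingHom.ker (PadicInt.toZMod (p := p)) := congrFun hx i
        rwa [PadicInt.ker_toZMod, PadicInt.maximalIdeal_eq_span_p, Ideal.mem_span_singleton] at this
      choose c hc using h
      refine ⟨b.equivFun.symm c, b.equivFun.injective (funext fun i ↦ ?_)⟩
      rw [hc, DistribSMul.toAddMonoidHom_apply, map_smul, LinearEquiv.apply_symm_apply]
      rfl
  rw [hk, AddSubgroup.index_ker, AddMonoidHom.range_eq_top.2 hs]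
  simp

theorem card_residueField_powerSeries_padicInt :
    Nat.card (IsLocalRing.ResidueField ℤ_[p]⟦X⟧) = p := by
  let f : ℤ_[p]⟦X⟧ →+* ZMod p := PadicInt.toZMod.comp constantCoeff
  have hf : Function.Surjective f := ZMod.ringHom_surjective f
  have hk : RingHom.ker f = IsLocalRing.maximalIdeal ℤ_[p]⟦X⟧ := by
    ext a
    rw [mem_maximalIdeal_powerSeries_padicInt, ← Ideal.mem_span_singleton,
      ← PadicInt.maximalIdeal_eq_span_p, ← PadicInt.ker_toZMod]
    rfl
  have e := (Ideal.quotEquivOfEq hk).symm.trans (RingHom.quotientKerEquivOfSurjective hf)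
  exact (Nat.card_congr e.toEquiv).trans (Nat.card_zmod p)

theorem exists_span_range_eq_top_of_nuPoly_smul_eq_zero {B : Type*} [AddCommGroup B]
    [Module ℤ_[p]⟦X⟧ B] [Module ℤ_[p] B] [IsScalarTower ℤ_[p] ℤ_[p]⟦X⟧ B]
    [Module.Free ℤ_[p] B] [Module.Finite ℤ_[p] B] {d : ℕ}
    (hr : Module.finrank ℤ_[p] B = d * (p - 1))
    (hB : ∀ x : B, (nuPoly p 1 : ℤ_[p]⟦X⟧) • x = 0) :
    ∃ v : Fin d → B, Submodule.span ℤ_[p]⟦X⟧ (Set.range v) = ⊤ := by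
  have hp := (Fact.out : p.Prime).two_le
  obtain ⟨w, hw⟩ := exists_nuPoly_one_eq p
  have hpc (b : B) : (p : ℤ_[p]) • b = (p : ℤ_[p]⟦X⟧) • b := by
    rw [Nat.cast_smul_eq_nsmul, Nat.cast_smul_eq_nsmul]
  have hX (b : B) : (X : ℤ_[p]⟦X⟧) ^ (p - 1) • b = (p : ℤ_[p]) • (-(w : ℤ_[p]⟦X⟧) • b) := by
    have := hB b
    rw [hw, add_smul, mul_smul] at this
    rw [eq_neg_of_add_eq_zero_left this, hpc, neg_smul, smul_neg]
  have hpX (b : B) : (p : ℤ_[p]) • b = (X : ℤ_[p]⟦X⟧) ^ (p - 1) • (-(↑w⁻¹ : ℤ_[p]⟦X⟧) • b) := by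
    rw [hX, smul_smul, neg_mul_neg, Units.mul_inv, one_smul]
  let f : B →+ B := DistribSMul.toAddMonoidHom B (X : ℤ_[p]⟦X⟧)
  have hf : Function.Injective f := by
    rw [injective_iff_map_eq_zero]
    intro b (hb : (X : ℤ_[p]⟦X⟧) • b = 0)
    have h1 : (p : ℤ_[p]) • (-(w : ℤ_[p]⟦X⟧) • b) = 0 := by
      rw [← hX, ← Nat.sub_add_cancel (by omega : 1 ≤ p - 1), pow_succ, mul_smul, hb, smul_zero]
    have h2 := (smul_eq_zero_iff_right (Nat.cast_ne_zero.2 (by omega : p ≠ 0))).1 h1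
    rw [neg_smul, neg_eq_zero] at h2
    simpa using congrArg ((↑w⁻¹ : ℤ_[p]⟦X⟧) • ·) h2
  have hrange : (DistribSMul.toAddMonoidHom B ((X : ℤ_[p]⟦X⟧) ^ (p - 1))).range =
      (DistribSMul.toAddMonoidHom B (p : ℤ_[p])).range := by
    ext b
    constructor
    · rintro ⟨c, rfl⟩
      exact ⟨_, (hX c).symm⟩
    · rintro ⟨c, rfl⟩
      exact ⟨_, (hpX c).symm⟩
  have hindex : (AddMonoidHom.range f).index = p ^ d := by
    have h := index_range_pow_smul hf (p - 1)
    rw [hrange, PadicInt.index_range_prime_smul, hr, pow_mul] at h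
    exact (Nat.pow_left_injective (by omega : p - 1 ≠ 0) h).symm
  have hm : (IsLocalRing.maximalIdeal ℤ_[p]⟦X⟧ • (⊤ : Submodule ℤ_[p]⟦X⟧ B)).toAddSubgroup =
      AddMonoidHom.range f := by
    apply le_antisymm
    · intro b hb
      refine Submodule.smul_induction_on hb (fun r hr n _ ↦ ?_) fun x y hx hy ↦ add_mem hx hy
      · rw [maximalIdeal_powerSeries_padicInt, Ideal.mem_span_pair] at hr
        obtain ⟨a, c, rfl⟩ := hr
        refine ⟨a • n + (X : ℤ_[p]⟦X⟧) ^ (p - 2) • (-(↑w⁻¹ : ℤ_[p]⟦X⟧) • (c • n)), ?_⟩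
        have := hpX (c • n)
        rw [hpc, show p - 1 = p - 2 + 1 by omega, pow_succ', mul_smul X] at this
        change (X : ℤ_[p]⟦X⟧) • (a • n + _ : B) = _
        rw [smul_add, ← this, add_smul, smul_smul, smul_smul, mul_comm X, mul_comm c]
    · rintro _ ⟨b, rfl⟩
      refine Submodule.smul_mem_smul ((mem_maximalIdeal_powerSeries_padicInt p).2 ?_)
        Submodule.mem_top
      simp
  have : Module.Finite ℤ_[p]⟦X⟧ B := .of_restrictScalars_finite ℤ_[p] _ _
  let k := IsLocalRing.ResidueField ℤ_[p]⟦X⟧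
  have hcard : Nat.card (TensorProduct ℤ_[p]⟦X⟧ k B) = p ^ d := by
    rw [← hindex, ← hm]
    exact Nat.card_congr
      (TensorProduct.quotTensorEquivQuotSMul B (IsLocalRing.maximalIdeal ℤ_[p]⟦X⟧)).toEquiv
  have hfin : Module.finrank k (TensorProduct ℤ_[p]⟦X⟧ k B) = d := by
    have h := Module.natCard_eq_pow_finrank (K := k) (V := TensorProduct ℤ_[p]⟦X⟧ k B)
    rw [hcard, card_residueField_powerSeries_padicInt] at h
    exact (Nat.pow_right_injective hp h).symm
  let b := Module.finBasisOfFinrankEq k (TensorProduct ℤ_[p]⟦X⟧ k B) hfin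
  choose v hv using fun i ↦
    TensorProduct.mk_surjective ℤ_[p]⟦X⟧ B k IsLocalRing.residue_surjective (b i)
  exact ⟨v, IsLocalRing.span_eq_top_of_tmul_eq_basis v b hv⟩

end Generators

section Structure
variable {p : ℕ} [Fact p.Prime] {M : Type*} [AddCommGroup M] [Module ℤ_[p]⟦X⟧ M]

theorem Ideal.mem_span_singleton_smul_top_iff {R N : Type*} [CommRing R] [AddCommGroup N]
    [Module R N] {r : R} {x : N} :
    x ∈ (Ideal.span {r} • ⊤ : Submodule R N) ↔ ∃ y, r • y = x := by
  rw [Submodule.ideal_span_singleton_smul, Submodule.mem_smul_pointwise_iff_exists]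
  simp

theorem PowerSeries.smul_eq_constantCoeff_smul {R N : Type*} [CommRing R] [AddCommGroup N]
    [Module R⟦X⟧ N] [Module R N] [IsScalarTower R R⟦X⟧ N] (hN : ∀ x : N, (X : R⟦X⟧) • x = 0)
    (f : R⟦X⟧) (x : N) : f • x = constantCoeff f • x := by
  conv_lhs => rw [sub_eq_iff_eq_add.1 (sub_const_eq_shift_mul_X f)]
  rw [add_smul, mul_smul, hN, smul_zero, zero_add, ← algebraMap_smul R⟦X⟧ (constantCoeff f),
    algebraMap_apply, Algebra.algebraMap_self_apply]

/-- Linear equivalences over `R` between modules killed by `X` are linear over `R⟦X⟧`. -/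
def LinearEquiv.extendScalarsPowerSeries {R A B : Type*} [CommRing R] [AddCommGroup A]
    [Module R⟦X⟧ A] [Module R A] [IsScalarTower R R⟦X⟧ A] [AddCommGroup B]
    [Module R⟦X⟧ B] [Module R B] [IsScalarTower R R⟦X⟧ B]
    (hA : ∀ a : A, (X : R⟦X⟧) • a = 0) (hB : ∀ b : B, (X : R⟦X⟧) • b = 0)
    (e : A ≃ₗ[R] B) : A ≃ₗ[R⟦X⟧] B :=
  { e with
    map_smul' := fun f a ↦ by
      change e (f • a) = f • e a
      rw [smul_eq_constantCoeff_smul hA, smul_eq_constantCoeff_smul hB, map_smul] }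

theorem Polynomial.isDistinguishedAt_X :
    (Polynomial.X : Polynomial ℤ_[p]).IsDistinguishedAt (IsLocalRing.maximalIdeal ℤ_[p]) where
  monic := Polynomial.monic_X
  mem {i} hi := by
    rw [Polynomial.natDegree_X, Nat.lt_one_iff] at hi
    simp [hi]

variable [Module ℤ_[p] M] [IsScalarTower ℤ_[p] ℤ_[p]⟦X⟧ M]

theorem finite_quotient_omega [Module.Finite ℤ_[p]⟦X⟧ M] (n : ℕ) : Module.Finite ℤ_[p]
    (M ⧸ (Ideal.span {(1 + X : ℤ_[p]⟦X⟧) ^ p ^ n - 1} • ⊤ : Submodule ℤ_[p]⟦X⟧ M)) := by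
  refine ((nuPoly_isDistinguishedAt p n).mul Polynomial.isDistinguishedAt_X).module_finite fun x ↦ ?_
  obtain ⟨m, rfl⟩ := Submodule.Quotient.mk_surjective _ x
  rw [Polynomial.coe_mul, Polynomial.coe_X, nuPoly_mul_X, ← Submodule.Quotient.mk_smul,
    Submodule.Quotient.mk_eq_zero, Ideal.mem_span_singleton_smul_top_iff]
  exact ⟨m, rfl⟩

/-- If `M ⧸ ω_n M` is free of rank `d p ^ n + δ` over `ℤ_[p]` for all `n`, then `X M` is free of
rank `d` over `ℤ_[p]⟦X⟧`. -/
theorem exists_basis_X_smul_top [Module.Finite ℤ_[p]⟦X⟧ M] {d δ : ℕ}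
    (hfree : ∀ n : ℕ, Module.Free ℤ_[p]
      (M ⧸ (Ideal.span {(1 + X : ℤ_[p]⟦X⟧) ^ p ^ n - 1} • ⊤ : Submodule ℤ_[p]⟦X⟧ M)))
    (hrank : ∀ n : ℕ, Module.finrank ℤ_[p]
      (M ⧸ (Ideal.span {(1 + X : ℤ_[p]⟦X⟧) ^ p ^ n - 1} • ⊤ : Submodule ℤ_[p]⟦X⟧ M)) =
        d * p ^ n + δ) :
    Nonempty (Module.Basis (Fin d) ℤ_[p]⟦X⟧
      (Ideal.span {(X : ℤ_[p]⟦X⟧)} • ⊤ : Submodule ℤ_[p]⟦X⟧ M)) := by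
  let W (n : ℕ) : Submodule ℤ_[p]⟦X⟧ M := Ideal.span {(1 + X : ℤ_[p]⟦X⟧) ^ p ^ n - 1} • ⊤
  set Q : Submodule ℤ_[p]⟦X⟧ M := Ideal.span {(X : ℤ_[p]⟦X⟧)} • ⊤ with hQ
  have hW0 : W 0 = Q := by simp [W, hQ]
  have hWQ (n) : W n ≤ Q := by
    intro x hx
    obtain ⟨y, rfl⟩ := Ideal.mem_span_singleton_smul_top_iff.1 hx
    exact Ideal.mem_span_singleton_smul_top_iff.2
      ⟨(nuPoly p n : ℤ_[p]⟦X⟧) • y, by rw [smul_smul, mul_comm, nuPoly_mul_X]⟩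
  have hWν (n) {x : M} (hx : x ∈ W n) : ∃ q : Q, (nuPoly p n : ℤ_[p]⟦X⟧) • (q : M) = x := by
    obtain ⟨y, rfl⟩ := Ideal.mem_span_singleton_smul_top_iff.1 hx
    exact ⟨⟨(X : ℤ_[p]⟦X⟧) • y, Ideal.mem_span_singleton_smul_top_iff.2 ⟨y, rfl⟩⟩,
      by rw [smul_smul, nuPoly_mul_X]⟩
  have hfinite (n) : Module.Finite ℤ_[p] (M ⧸ W n) := finite_quotient_omega n
  have hfree' (n) : Module.Free ℤ_[p] (M ⧸ W n) := hfree n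
  let S (n : ℕ) : Submodule ℤ_[p]⟦X⟧ (M ⧸ W n) := Q.map (W n).mkQ
  have hSfree (n) : Module.Free ℤ_[p] (S n) :=
    inferInstanceAs (Module.Free ℤ_[p] ((S n).restrictScalars ℤ_[p]))
  have hSfin (n) : Module.Finite ℤ_[p] (S n) :=
    inferInstanceAs (Module.Finite ℤ_[p] ((S n).restrictScalars ℤ_[p]))
  have hSrank (n) : Module.finrank ℤ_[p] (S n) = d * (p ^ n - 1) := by
    have h1 := Submodule.finrank_quotient_add_finrank ((S n).restrictScalars ℤ_[p])
    have h2 : Module.finrank ℤ_[p] ((M ⧸ W n) ⧸ (S n).restrictScalars ℤ_[p]) =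
        Module.finrank ℤ_[p] (M ⧸ Q) :=
      ((Submodule.quotientQuotientEquivQuotient (W n) Q (hWQ n)).restrictScalars
        ℤ_[p]).finrank_eq
    have h3 := hrank 0
    rw [show (Ideal.span {(1 + X : ℤ_[p]⟦X⟧) ^ p ^ 0 - 1} • ⊤ : Submodule ℤ_[p]⟦X⟧ M) = Q from hW0]
      at h3
    have h4 : Module.finrank ℤ_[p] (M ⧸ W n) = d * p ^ n + δ := hrank n
    have h5 : Module.finrank ℤ_[p] ((S n).restrictScalars ℤ_[p]) =
      Module.finrank ℤ_[p] (S n) := rfl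
    rw [h2, h3, h4, h5] at h1
    rw [pow_zero, mul_one] at h1
    rw [Nat.mul_sub, mul_one]
    omega
  have hSν (n) (x : S n) : (nuPoly p n : ℤ_[p]⟦X⟧) • x = 0 := by
    obtain ⟨_, y, hy, rfl⟩ := x
    obtain ⟨z, rfl⟩ := Ideal.mem_span_singleton_smul_top_iff.1 hy
    refine Subtype.ext ((Submodule.Quotient.mk_eq_zero (W n)).2 ?_)
    refine Ideal.mem_span_singleton_smul_top_iff.2 ⟨z, ?_⟩
    rw [← nuPoly_mul_X, mul_smul]
  let π (n : ℕ) : Q →ₗ[ℤ_[p]⟦X⟧] S n := (W n).mkQ.submoduleMap Q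
  have hπ (n) : Function.Surjective (π n) := (W n).mkQ.submoduleMap_surjective Q
  obtain ⟨v, hv⟩ := exists_span_range_eq_top_of_nuPoly_smul_eq_zero (p := p) (B := S 1) (d := d)
    (by rw [hSrank, pow_one]) (hSν 1)
  choose u hu using fun i ↦ hπ 1 (v i)
  have hker (n) {x : Q} (hx : π n x = 0) : ∃ q : Q, (nuPoly p n : ℤ_[p]⟦X⟧) • q = x := by
    obtain ⟨q, hq⟩ := hWν n ((Submodule.Quotient.mk_eq_zero (W n)).1 (congrArg Subtype.val hx))
    exact ⟨q, Subtype.ext hq⟩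
  have hspan : Submodule.span ℤ_[p]⟦X⟧ (Set.range u) = ⊤ := by
    have : Module.Finite ℤ_[p]⟦X⟧ Q := inferInstance
    refine top_le_iff.1 (Submodule.le_of_le_smul_of_le_jacobson_bot (Module.Finite.fg_top)
      (IsLocalRing.maximalIdeal_le_jacobson ⊥) fun x _ ↦ ?_)
    obtain ⟨a, ha⟩ := (Submodule.mem_span_range_iff_exists_fun ℤ_[p]⟦X⟧).1
      (hv ▸ Submodule.mem_top : π 1 x ∈ _)
    obtain ⟨q, hq⟩ := hker 1 (x := x - ∑ i, a i • u i) (by simp [hu, ha])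
    rw [← sub_add_cancel x (∑ i, a i • u i), ← hq, add_comm]
    refine Submodule.add_mem_sup (Submodule.mem_span_range_iff_exists_fun _ |>.2 ⟨a, rfl⟩)
      (Submodule.smul_mem_smul ?_ Submodule.mem_top)
    rw [mem_maximalIdeal_powerSeries_padicInt]
    simp [coeff_nuPoly]
  have hli : LinearIndependent ℤ_[p]⟦X⟧ u := by
    rw [Fintype.linearIndependent_iff]
    intro a ha i
    refine eq_zero_of_forall_mem_span_nuPoly p fun n ↦ ?_
    refine (nuPoly_isDistinguishedAt p n).mem_span_of_sum_smul_eq_zero (hSν n)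
      (by rw [hSrank, natDegree_nuPoly]) (v := π n ∘ u) ?_ (by simpa using congrArg (π n) ha) i
    rw [Set.range_comp, Submodule.span_image, hspan, Submodule.map_top,
      LinearMap.range_eq_top.2 (hπ n)]
  exact ⟨.mk hli hspan.ge⟩

/-- If `X M` is free over `ℤ_[p]⟦X⟧`, then multiplication by `X` splits `M` as the sum of a copy
of `X M` and the `X`-torsion of `M`. -/
theorem nonempty_linearEquiv_prod {d δ : ℕ}
    [Module.Free ℤ_[p] (M ⧸ (Ideal.span {(X : ℤ_[p]⟦X⟧)} • ⊤ : Submodule ℤ_[p]⟦X⟧ M))]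
    [Module.Finite ℤ_[p] (M ⧸ (Ideal.span {(X : ℤ_[p]⟦X⟧)} • ⊤ : Submodule ℤ_[p]⟦X⟧ M))]
    (hrank : Module.finrank ℤ_[p]
      (M ⧸ (Ideal.span {(X : ℤ_[p]⟦X⟧)} • ⊤ : Submodule ℤ_[p]⟦X⟧ M)) = d + δ)
    (b : Module.Basis (Fin d) ℤ_[p]⟦X⟧
      (Ideal.span {(X : ℤ_[p]⟦X⟧)} • ⊤ : Submodule ℤ_[p]⟦X⟧ M)) :
    Nonempty (M ≃ₗ[ℤ_[p]⟦X⟧] (Fin d → ℤ_[p]⟦X⟧) ×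
      (Fin δ → ℤ_[p]⟦X⟧ ⧸ (Ideal.span {(X : ℤ_[p]⟦X⟧)} : Ideal ℤ_[p]⟦X⟧))) := by
  set Q : Submodule ℤ_[p]⟦X⟧ M := Ideal.span {(X : ℤ_[p]⟦X⟧)} • ⊤ with hQ
  have hQmem {x : M} : x ∈ Q ↔ ∃ y, (X : ℤ_[p]⟦X⟧) • y = x :=
    Ideal.mem_span_singleton_smul_top_iff
  obtain ⟨_, _, hΛ⟩ := Polynomial.isDistinguishedAt_X (p := p).powerSeries_quotient
  rw [Polynomial.natDegree_X] at hΛ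
  rw [Polynomial.coe_X] at *
  let φ : M →ₗ[ℤ_[p]⟦X⟧] (Fin d → ℤ_[p]⟦X⟧) := b.equivFun.toLinearMap ∘ₗ
    (LinearMap.lsmul ℤ_[p]⟦X⟧ M X).codRestrict Q fun y ↦ hQmem.2 ⟨y, rfl⟩
  have hφ : Function.Surjective φ := by
    refine b.equivFun.surjective.comp fun x ↦ ?_
    obtain ⟨y, hy⟩ := hQmem.1 x.2
    exact ⟨y, Subtype.ext hy⟩
  have hφ0 {x : M} : φ x = 0 ↔ (X : ℤ_[p]⟦X⟧) • x = 0 :=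
    b.equivFun.map_eq_zero_iff.trans (Subtype.ext_iff (p := (· ∈ Q)))
  obtain ⟨s, hs⟩ := Module.projective_lifting_property φ LinearMap.id hφ
  replace hs (a) : φ (s a) = a := LinearMap.congr_fun hs a
  let T := LinearMap.ker φ
  let ψ : (M ⧸ Q) →ₗ[ℤ_[p]⟦X⟧] (Fin d → ℤ_[p]⟦X⟧ ⧸ Ideal.span {(X : ℤ_[p]⟦X⟧)}) :=
    Q.liftQ (LinearMap.pi fun i ↦ Submodule.mkQ _ ∘ₗ LinearMap.proj i ∘ₗ φ) <| by
      intro x hx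
      obtain ⟨y, rfl⟩ := hQmem.1 hx
      refine LinearMap.mem_ker.2 (funext fun i ↦ (Submodule.Quotient.mk_eq_zero _).2 ?_)
      rw [LinearMap.comp_apply, LinearMap.proj_apply, map_smul]
      exact Ideal.mem_span_singleton.2 ⟨φ y i, rfl⟩
  have hψ_mk (x : M) (i) : ψ (Q.mkQ x) i = Submodule.Quotient.mk (φ x i) := rfl
  have hψ : Function.Surjective ψ := fun y ↦ by
    choose z hz using fun i ↦ Submodule.Quotient.mk_surjective _ (y i)
    obtain ⟨x, hx⟩ := hφ z
    exact ⟨Q.mkQ x, funext fun i ↦ by rw [hψ_mk, hx, hz]⟩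
  let τ : T →ₗ[ℤ_[p]⟦X⟧] LinearMap.ker ψ := (Q.mkQ ∘ₗ T.subtype).codRestrict _ fun t ↦ by
    refine LinearMap.mem_ker.2 (funext fun i ↦ ?_)
    rw [LinearMap.comp_apply, hψ_mk, T.subtype_apply, LinearMap.mem_ker.1 t.2]
    rfl
  have hτ : Function.Bijective τ := by
    constructor
    · rw [injective_iff_map_eq_zero]
      rintro ⟨t, ht⟩ h
      obtain ⟨m, rfl⟩ := hQmem.1 ((Submodule.Quotient.mk_eq_zero Q).1 (congrArg Subtype.val h))
      have h1 : (X : ℤ_[p]⟦X⟧) • φ m = 0 := by rw [← map_smul]; exact ht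
      have h2 : φ m = 0 := (smul_eq_zero_iff_right X_ne_zero).1 h1
      exact Subtype.ext (hφ0.1 h2)
    · rintro ⟨x, hx⟩
      obtain ⟨m, rfl⟩ := Q.mkQ_surjective x
      have h (i) : ∃ c, φ m i = X * c := Ideal.mem_span_singleton.1 <|
        (Submodule.Quotient.mk_eq_zero _).1 ((hψ_mk m i).symm.trans (congrFun hx i))
      choose c hc using h
      refine ⟨⟨m - (X : ℤ_[p]⟦X⟧) • s c, ?_⟩, Subtype.ext ?_⟩
      · rw [LinearMap.mem_ker, map_sub, map_smul, hs, sub_eq_zero]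
        exact funext hc
      · change Q.mkQ (m - _) = Q.mkQ m
        rw [map_sub, sub_eq_self, Submodule.mkQ_apply, Submodule.Quotient.mk_eq_zero]
        exact hQmem.2 ⟨_, rfl⟩
  let τe : T ≃ₗ[ℤ_[p]] LinearMap.ker (ψ.restrictScalars ℤ_[p]) :=
    (LinearEquiv.ofBijective τ hτ).restrictScalars ℤ_[p]
  have : Module.Free ℤ_[p] T := .of_equiv τe.symm
  have : Module.Finite ℤ_[p] T := .equiv τe.symm
  have hT : Module.finrank ℤ_[p] T =
      Module.finrank ℤ_[p] (Fin δ → ℤ_[p]⟦X⟧ ⧸ Ideal.span {(X : ℤ_[p]⟦X⟧)}) := by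
    have h := Submodule.finrank_quotient_add_finrank (LinearMap.ker (ψ.restrictScalars ℤ_[p]))
    rw [((ψ.restrictScalars ℤ_[p]).quotKerEquivOfSurjective hψ).finrank_eq, hrank, ← τe.finrank_eq,
      Module.finrank_pi_fintype] at h
    rw [Module.finrank_pi_fintype]
    simp only [hΛ, Finset.sum_const, Finset.card_univ, Fintype.card_fin, smul_eq_mul,
      mul_one] at h ⊢
    omega
  let e : T ≃ₗ[ℤ_[p]⟦X⟧] (Fin δ → ℤ_[p]⟦X⟧ ⧸ Ideal.span {(X : ℤ_[p]⟦X⟧)}) :=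
    LinearEquiv.extendScalarsPowerSeries (fun t ↦ Subtype.ext (hφ0.1 t.2))
      (fun y ↦ funext fun i ↦ by
        obtain ⟨z, hz⟩ := Submodule.Quotient.mk_surjective _ (y i)
        rw [Pi.smul_apply, ← hz, ← Submodule.Quotient.mk_smul]
        exact (Submodule.Quotient.mk_eq_zero _).2 (Ideal.mem_span_singleton.2 ⟨z, rfl⟩))
      (LinearEquiv.ofFinrankEq _ _ hT)
  let ρ : M →ₗ[ℤ_[p]⟦X⟧] T := (LinearMap.id - s ∘ₗ φ).codRestrict T fun m ↦ by
    simp [T, hs]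
  have hρ (m : M) : (ρ m : M) = m - s (φ m) := rfl
  refine ⟨.ofBijective (φ.prod (e.toLinearMap ∘ₗ ρ)) ⟨?_, ?_⟩⟩
  · rw [injective_iff_map_eq_zero]
    intro m hm
    obtain ⟨h1, h2⟩ := Prod.ext_iff.1 hm
    have h3 := hρ m
    rw [e.map_eq_zero_iff.1 h2, show φ m = 0 from h1, map_zero, sub_zero] at h3
    exact h3.symm
  · rintro ⟨a, y⟩
    have ht : φ (e.symm y : M) = 0 := (e.symm y).2
    have h1 : φ (s a + (e.symm y : M)) = a := by rw [map_add, hs, ht, add_zero]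
    refine ⟨s a + (e.symm y : M), Prod.ext h1 ?_⟩
    have h2 : ρ (s a + (e.symm y : M)) = e.symm y :=
      Subtype.ext (by rw [hρ, h1, add_sub_cancel_left])
    change e (ρ _) = y
    rw [h2, e.apply_symm_apply]

end Structure

end


/-- Let `d ≥ 0`, `δ ∈ {0, 2}`, and let `M` be a finitely generated `Λ`-module
(`Λ = ℤ_p[[X]]`) such that for every `n ≥ 0` the quotient `M/ω_n M` is a free
`ℤ_p`-module of rank `d·p^n + δ`, where `ω_n = (1+X)^{p^n} − 1`. Then there is an
injective `Λ`-homomorphism `M → Λ^d ⊕ (Λ/XΛ)^δ` with finite cokernel. -/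
theorem stmt15 (p : ℕ) [Fact p.Prime] (d δ : ℕ) (hδ : δ = 0 ∨ δ = 2)
    (M : Type*) [AddCommGroup M] [Module (PowerSeries ℤ_[p]) M]
    [Module.Finite (PowerSeries ℤ_[p]) M]
    [Module ℤ_[p] M] [IsScalarTower ℤ_[p] (PowerSeries ℤ_[p]) M]
    (hfree : ∀ n : ℕ, Module.Free ℤ_[p]
      (M ⧸ (Ideal.span {(1 + PowerSeries.X : PowerSeries ℤ_[p]) ^ p ^ n - 1} • ⊤ :
        Submodule (PowerSeries ℤ_[p]) M)))
    (hrank : ∀ n : ℕ, Module.finrank ℤ_[p]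
      (M ⧸ (Ideal.span {(1 + PowerSeries.X : PowerSeries ℤ_[p]) ^ p ^ n - 1} • ⊤ :
        Submodule (PowerSeries ℤ_[p]) M)) = d * p ^ n + δ) :
    ∃ f : M →ₗ[PowerSeries ℤ_[p]]
        (Fin d → PowerSeries ℤ_[p]) ×
        (Fin δ → PowerSeries ℤ_[p] ⧸
          (Ideal.span {(PowerSeries.X : PowerSeries ℤ_[p])} : Ideal (PowerSeries ℤ_[p]))),
      Function.Injective f ∧
      Finite (((Fin d → PowerSeries ℤ_[p]) ×
        (Fin δ → PowerSeries ℤ_[p] ⧸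
          (Ideal.span {(PowerSeries.X : PowerSeries ℤ_[p])} : Ideal (PowerSeries ℤ_[p])))) ⧸
        LinearMap.range f) := by
  obtain ⟨b⟩ := exists_basis_X_smul_top hfree hrank
  have h0 : (Ideal.span {(1 + PowerSeries.X : PowerSeries ℤ_[p]) ^ p ^ 0 - 1} • ⊤ :
      Submodule (PowerSeries ℤ_[p]) M) = Ideal.span {(PowerSeries.X : PowerSeries ℤ_[p])} • ⊤ := by
    simp
  have hfree0 := hfree 0
  have hfin0 := finite_quotient_omega (p := p) (M := M) 0
  have hrank0 := hrank 0
  rw [h0] at hfree0 hfin0 hrank0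
  rw [pow_zero, mul_one] at hrank0
  obtain ⟨e⟩ := nonempty_linearEquiv_prod hrank0 b
  refine ⟨e.toLinearMap, e.injective, ?_⟩
  rw [LinearEquiv.range]
  infer_instance
end

section
/- Let d ≥ 0 be an integer and δ ∈ {0, 2}. Let M be a finitely generated Λ-module such that for every n ≥ 0, the quotient M/ω_n M is a free ℤ_p-module of rank d·p^n + δ. Then M is isomorphic as a Λ-module to Λ^{⊕ d} ⊕ (Λ/XΛ)^{⊕ δ}. -/
theorem exists_fin_span_eq_top_of_length_le {R : Type*} [Ring R] (n : ℕ) (V : Type*)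
    [AddCommGroup V] [Module R V] (h : Module.length R V ≤ n) :
    ∃ v : Fin n → V, Submodule.span R (Set.range v) = ⊤ := by
  induction n generalizing V with
  | zero =>
    have : Subsingleton V := Module.length_eq_zero_iff.mp (by simpa using h)
    exact ⟨0, Subsingleton.elim _ _⟩
  | succ n ih =>
    rcases subsingleton_or_nontrivial V with _ | _
    · exact ⟨0, Subsingleton.elim _ _⟩
    obtain ⟨x, hx⟩ := exists_ne (0 : V)
    have hexact := Module.length_eq_add_of_exact (Submodule.span R {x}).subtype
      (Submodule.span R {x}).mkQ (Submodule.subtype_injective _) (Submodule.mkQ_surjective _)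
      (LinearMap.exact_subtype_mkQ _)
    have : Nontrivial (Submodule.span R {x}) :=
      (Submodule.nontrivial_iff_ne_bot).mpr (by simpa using hx)
    have hone : 1 ≤ Module.length R (Submodule.span R {x}) :=
      Order.one_le_iff_pos.mpr Module.length_pos
    have hle : Module.length R (V ⧸ Submodule.span R {x}) ≤ n := by
      have h1 : 1 + Module.length R (V ⧸ Submodule.span R {x}) ≤ 1 + n :=
        (add_le_add_left hone _).trans (hexact ▸ (by simpa [add_comm] using h))
      exact (ENat.add_le_add_iff_left (by simp)).mp h1
    obtain ⟨v, hv⟩ := ih _ hle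
    choose w hw using fun i => Submodule.mkQ_surjective _ (v i)
    refine ⟨Fin.cons x w, ?_⟩
    have hmap : (Submodule.span R (Set.range w)).map (Submodule.span R {x}).mkQ = ⊤ := by
      rw [Submodule.map_span, ← Set.range_comp, ← hv]
      congr 2
      exact funext hw
    rw [Fin.range_cons, Submodule.span_insert, ← Submodule.comap_map_mkQ, hmap,
      Submodule.comap_top]

theorem length_eq_finrank_of_surjective_of_ker {R F Q : Type*} [CommRing R] [Nontrivial R]
    [AddCommGroup F] [Module R F] [AddCommGroup Q] [Module R Q] [Module.Free R F]
    [Module.Finite R F] (π : R) (hπ : (Ideal.span {π}).IsMaximal) (h : F →ₗ[R] Q)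
    (hsurj : Function.Surjective h) (hker : ∀ x, h x = 0 ↔ ∃ y, π • y = x) :
    Module.length R Q = Module.finrank R F := by
  let e : F ≃ₗ[R] (Fin (Module.finrank R F) → R) := (Module.finBasis R F).equivFun
  let g : F →ₗ[R] (Fin (Module.finrank R F) → R ⧸ Ideal.span {π}) :=
    (LinearMap.pi fun i => (Ideal.span {π}).mkQ ∘ₗ LinearMap.proj i) ∘ₗ e.toLinearMap
  have hg : Function.Surjective g := by
    intro y
    choose z hz using fun i => Submodule.mkQ_surjective _ (y i)
    exact ⟨e.symm z, by ext i; simpa [g] using hz i⟩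
  have hgker : LinearMap.ker h = LinearMap.ker g := by
    ext x
    rw [LinearMap.mem_ker, hker, LinearMap.mem_ker]
    constructor
    · rintro ⟨y, rfl⟩
      ext i
      refine Ideal.Quotient.eq_zero_iff_mem.mpr (Ideal.mem_span_singleton.mpr ⟨e y i, ?_⟩)
      simp
    · intro hx
      have hdvd : ∀ i, ∃ c, e x i = π * c := fun i => by
        have := congrFun hx i
        exact Ideal.mem_span_singleton.mp (Ideal.Quotient.eq_zero_iff_mem.mp this)
      choose c hc using hdvd
      refine ⟨e.symm c, e.injective ?_⟩
      ext i
      simp [hc]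
  have : IsSimpleModule R (R ⧸ Ideal.span {π}) :=
    isSimpleModule_iff_isCoatom.mpr hπ.out
  rw [← (h.quotKerEquivOfSurjective hsurj).length_eq, (Submodule.quotEquivOfEq _ _ hgker).length_eq,
    (g.quotKerEquivOfSurjective hg).length_eq, Module.length_pi_of_fintype]
  simp [Module.length_eq_one]

theorem eq_and_eq_of_antitone_increments {p d δ : ℕ} (hp : 2 ≤ p) {a l : ℕ → ℕ} (ha : Antitone a)
    (hl0 : l 0 = 0) (hl : ∀ k, l (k + 1) = a k + l k)
    (hlp : ∀ n, l (p ^ n) = d * p ^ n + δ) : a 0 = d + δ ∧ a 1 = d := by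
  have h1 : l 1 = d + δ := by simpa using hlp 0
  have hl01 : l 1 = a 0 := by rw [hl 0, hl0, add_zero]
  have hge : ∀ k, d ≤ a k := by
    intro k
    by_contra! hk
    have hgrow : ∀ n, l (k + n) + n ≤ l k + n * d := by
      intro n
      induction n with
      | zero => simp
      | succ n ih =>
        have := ha (Nat.le_add_right k n)
        rw [← add_assoc k n 1, hl, add_one_mul]
        omega
    have hlt : k + l k < p ^ (k + l k) := Nat.lt_pow_self hp
    obtain ⟨m, hm⟩ := Nat.exists_eq_add_of_le (show k ≤ p ^ (k + l k) by omega)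
    have h2 := hgrow m
    rw [← hm, hlp, hm] at h2
    nlinarith
  have hgrow : ∀ m, l 2 + m * d ≤ l (2 + m) := by
    intro m
    induction m with
    | zero => simp
    | succ m ih =>
      have := hge (2 + m)
      rw [← add_assoc 2 m 1, hl (2 + m), add_one_mul]
      omega
  obtain ⟨m, rfl⟩ := Nat.exists_eq_add_of_le hp
  have h2 := hgrow m
  have h3 := hlp 1
  rw [pow_one] at h3
  have h4 := hl 1
  have h5 := hge 1
  simp only [Nat.reduceAdd] at h4
  refine ⟨by omega, ?_⟩
  nlinarith

/-- The submodule `π M + x ^ k M`. -/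
def smulAddPowSMul {A : Type*} (M : Type*) [CommRing A] [AddCommGroup M] [Module A M]
    (π x : A) (k : ℕ) : Submodule A M :=
  LinearMap.range ((LinearMap.lsmul A M π).coprod (LinearMap.lsmul A M (x ^ k)))

section Filtration

variable {A M : Type*} [CommRing A] [AddCommGroup M] [Module A M] {π x : A}

theorem mem_smulAddPowSMul {k : ℕ} {m : M} :
    m ∈ smulAddPowSMul M π x k ↔ ∃ a b : M, π • a + x ^ k • b = m := by
  simp [smulAddPowSMul]

theorem smulAddPowSMul_succ_le (k : ℕ) :
    smulAddPowSMul M π x (k + 1) ≤ smulAddPowSMul M π x k := by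
  intro m hm
  obtain ⟨a, b, rfl⟩ := mem_smulAddPowSMul.mp hm
  exact mem_smulAddPowSMul.mpr ⟨a, x • b, by rw [pow_succ, mul_smul]⟩

variable (M π x) in
/-- The elements `m` with `x ^ k m ∈ π M + x ^ (k + 1) M`; the quotient of `M` by them is the `k`-th
graded piece of the `x`-adic filtration of `M / π M`. -/
def gradedKernel (k : ℕ) : Submodule A M :=
  (smulAddPowSMul M π x (k + 1)).comap (LinearMap.lsmul A M (x ^ k))

theorem mem_gradedKernel {k : ℕ} {m : M} :
    m ∈ gradedKernel M π x k ↔ ∃ a b : M, π • a + x ^ (k + 1) • b = x ^ k • m := by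
  simp [gradedKernel, mem_smulAddPowSMul]

theorem gradedKernel_zero : gradedKernel M π x 0 = smulAddPowSMul M π x 1 := by
  ext m
  simp [mem_gradedKernel, mem_smulAddPowSMul]

theorem gradedKernel_mono : Monotone (gradedKernel M π x) := by
  refine monotone_nat_of_le_succ fun k m hm => ?_
  obtain ⟨a, b, h⟩ := mem_gradedKernel.mp hm
  refine mem_gradedKernel.mpr ⟨x • a, b, ?_⟩
  rw [pow_succ' x k, mul_smul x, ← h, pow_succ' x (k + 1), mul_smul x, smul_add, smul_comm π x]

variable (R : Type*) [CommRing R] [Algebra R A] [Module R M] [IsScalarTower R A M]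

theorem length_quotient_eq_add {P : Type*} [AddCommGroup P] [Module A P] [Module R P]
    [IsScalarTower R A P] (f : P →ₗ[A] M) {N N' : Submodule A M} (h : N ≤ N')
    (hN' : ∀ m, m ∈ N' ↔ ∃ z, f z - m ∈ N) :
    Module.length R (M ⧸ N) = Module.length R (P ⧸ N.comap f) + Module.length R (M ⧸ N') := by
  refine Module.length_eq_add_of_exact
    ((Submodule.mapQ (N.comap f) N f le_rfl).restrictScalars R)
    ((Submodule.factor h).restrictScalars R) ?_ (Submodule.factor_surjective h) ?_
  · rw [LinearMap.coe_restrictScalars, ← LinearMap.ker_eq_bot]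
    exact Submodule.ker_liftQ_eq_bot _ _ _ (by simp [LinearMap.ker_comp])
  · intro y
    obtain ⟨m, rfl⟩ := N.mkQ_surjective y
    constructor
    · intro hm
      have hm' : m ∈ N' := by simpa using hm
      obtain ⟨z, hz⟩ := (hN' m).mp hm'
      exact ⟨Submodule.Quotient.mk z, (Submodule.Quotient.eq _).mpr hz⟩
    · rintro ⟨z, hz⟩
      obtain ⟨z, rfl⟩ := Submodule.mkQ_surjective _ z
      rw [← hz]
      exact (Submodule.Quotient.mk_eq_zero N').mpr ((hN' _).mpr ⟨z, by simp⟩)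

theorem length_quotient_smulAddPowSMul_succ (k : ℕ) :
    Module.length R (M ⧸ smulAddPowSMul M π x (k + 1)) =
      Module.length R (M ⧸ gradedKernel M π x k) +
        Module.length R (M ⧸ smulAddPowSMul M π x k) := by
  refine length_quotient_eq_add R (LinearMap.lsmul A M (x ^ k)) (smulAddPowSMul_succ_le k) ?_
  intro m
  simp only [mem_smulAddPowSMul, LinearMap.lsmul_apply]
  constructor
  · rintro ⟨a, b, rfl⟩
    exact ⟨b, -a, 0, by simp⟩
  · rintro ⟨z, a, b, h⟩
    refine ⟨-a, z - x • b, ?_⟩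
    rw [smul_neg, smul_sub, smul_smul, ← pow_succ, ← sub_sub_cancel (x ^ k • z) m, ← h]
    abel

theorem length_quotient_antitone : Antitone fun N : Submodule A M => Module.length R (M ⧸ N) :=
  fun _ _ h => Module.length_le_of_surjective ((Submodule.factor h).restrictScalars R)
    (Submodule.factor_surjective h)

theorem length_quotient_gradedKernel {p d δ : ℕ} (hp : 2 ≤ p)
    (h : ∀ n, Module.length R (M ⧸ smulAddPowSMul M π x (p ^ n)) = (d * p ^ n + δ : ℕ)) :
    Module.length R (M ⧸ gradedKernel M π x 0) = (d + δ : ℕ) ∧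
      Module.length R (M ⧸ gradedKernel M π x 1) = d := by
  have hanti : Antitone fun k => Module.length R (M ⧸ gradedKernel M π x k) :=
    (length_quotient_antitone R).comp_monotone gradedKernel_mono
  have hbot : Module.length R (M ⧸ smulAddPowSMul M π x 0) = 0 := by
    have : smulAddPowSMul M π x 0 = ⊤ :=
      eq_top_iff.mpr fun m _ => mem_smulAddPowSMul.mpr ⟨0, m, by simp⟩
    rw [this]
    exact Module.length_eq_zero
  have hfin : ∀ k, Module.length R (M ⧸ gradedKernel M π x k) ≠ ⊤ := fun k => by
    refine ne_top_of_le_ne_top ?_ (hanti (Nat.zero_le k))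
    have := length_quotient_smulAddPowSMul_succ (M := M) (π := π) (x := x) R 0
    rw [hbot, add_zero] at this
    dsimp only
    rw [← this, show 0 + 1 = p ^ 0 by simp, h]
    exact ENat.natCast_ne_top _
  choose a ha using fun k => ENat.ne_top_iff_exists.mp (hfin k)
  have hfin' : ∀ k, Module.length R (M ⧸ smulAddPowSMul M π x k) ≠ ⊤ := fun k => by
    induction k with
    | zero => simp [hbot]
    | succ k ih =>
      rw [length_quotient_smulAddPowSMul_succ]
      exact WithTop.add_ne_top.mpr ⟨hfin k, ih⟩
  choose l hl using fun k => ENat.ne_top_iff_exists.mp (hfin' k)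
  have := eq_and_eq_of_antitone_increments hp (a := a) (l := l) (d := d) (δ := δ)
    (fun i j hij => by have := hanti hij; simp only [← ha] at this; exact_mod_cast this)
    (by have := hl 0; rw [hbot] at this; exact_mod_cast this)
    (fun k => by
      have := length_quotient_smulAddPowSMul_succ (M := M) (π := π) (x := x) R k
      rw [← hl, ← hl, ← ha] at this
      exact_mod_cast this)
    (fun n => by have := h n; rw [← hl] at this; exact_mod_cast this)
  rw [← ha, ← ha, this.1, this.2]
  exact ⟨rfl, rfl⟩

end Filtration

section IwasawaAlgebra

variable {p : ℕ} [Fact p.Prime]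

theorem exists_one_add_X_pow_sub_one_eq (n : ℕ) :
    ∃ r : PowerSeries ℤ_[p], (1 + PowerSeries.X : PowerSeries ℤ_[p]) ^ p ^ n - 1 =
      PowerSeries.X ^ p ^ n + (p : PowerSeries ℤ_[p]) * r := by
  obtain ⟨r, hr⟩ := exists_add_pow_prime_pow_eq (Fact.out : p.Prime)
    (1 : PowerSeries ℤ_[p]) PowerSeries.X n
  exact ⟨PowerSeries.X * r, by rw [hr]; ring⟩

theorem exists_eq_mul_add_sum_of_eq_X_pow_add {g r : PowerSeries ℤ_[p]} {k : ℕ}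
    (hg : g = PowerSeries.X ^ k + (p : PowerSeries ℤ_[p]) * r) (f : PowerSeries ℤ_[p]) :
    ∃ (q : PowerSeries ℤ_[p]) (c : Fin k → ℤ_[p]),
      f = g * q + ∑ i : Fin k, c i • (PowerSeries.X : PowerSeries ℤ_[p]) ^ (i : ℕ) := by
  have hmap : g.map (IsLocalRing.residue ℤ_[p]) = PowerSeries.X ^ k := by
    have hp : IsLocalRing.residue ℤ_[p] (p : ℤ_[p]) = 0 := by
      rw [IsLocalRing.residue_eq_zero_iff, PadicInt.maximalIdeal_eq_span_p]
      exact Ideal.mem_span_singleton_self _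
    rw [map_natCast] at hp
    rw [hg, map_add, map_mul, map_pow, PowerSeries.map_X, map_natCast,
      ← map_natCast (PowerSeries.C (R := IsLocalRing.ResidueField ℤ_[p])), hp]
    simp
  obtain ⟨q, s, hs⟩ := f.exists_isWeierstrassDivision (g := g)
    (by rw [hmap]; exact pow_ne_zero _ PowerSeries.X_ne_zero)
  have hdeg : s.degree < k := by
    have h := hs.degree_lt
    change s.degree < ((g.map (IsLocalRing.residue ℤ_[p])).order.toNat : ℕ) at h
    rwa [hmap, PowerSeries.order_X_pow, ENat.toNat_natCast] at h
  refine ⟨q, fun i => s.coeff i, ?_⟩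
  rw [hs.eq_mul_add]
  congr 1
  ext m
  rw [Fin.sum_univ_eq_sum_range (fun i => s.coeff i • (PowerSeries.X : PowerSeries ℤ_[p]) ^ i)]
  simp only [Polynomial.coeff_coe, map_sum, PowerSeries.coeff_smul, PowerSeries.coeff_X_pow,
    smul_eq_mul, mul_ite, mul_one, mul_zero, Finset.sum_ite_eq, Finset.mem_range]
  split_ifs with hm
  · rfl
  · exact Polynomial.coeff_eq_zero_of_degree_lt (hdeg.trans_le (by exact_mod_cast not_lt.mp hm))

theorem smul_mem_of_forall_X_pow_smul_mem {M : Type*} [AddCommGroup M]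
    [Module (PowerSeries ℤ_[p]) M] [Module ℤ_[p] M] [IsScalarTower ℤ_[p] (PowerSeries ℤ_[p]) M]
    {g r : PowerSeries ℤ_[p]} {k : ℕ}
    (hg : g = PowerSeries.X ^ k + (p : PowerSeries ℤ_[p]) * r) {T : Submodule ℤ_[p] M}
    (hT : ∀ m : M, g • m ∈ T) {v : M}
    (hv : ∀ i : Fin k, (PowerSeries.X : PowerSeries ℤ_[p]) ^ (i : ℕ) • v ∈ T)
    (f : PowerSeries ℤ_[p]) : f • v ∈ T := by
  obtain ⟨q, c, rfl⟩ := exists_eq_mul_add_sum_of_eq_X_pow_add hg f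
  rw [add_smul, mul_smul, Finset.sum_smul]
  refine T.add_mem (hT _) (T.sum_mem fun i _ => ?_)
  rw [smul_assoc]
  exact T.smul_mem _ (hv i)

theorem natCast_mem_maximalIdeal :
    (p : PowerSeries ℤ_[p]) ∈ IsLocalRing.maximalIdeal (PowerSeries ℤ_[p]) := by
  rw [IsLocalRing.mem_maximalIdeal, mem_nonunits_iff, PowerSeries.isUnit_iff_constantCoeff,
    map_natCast]
  exact PadicInt.prime_p.not_isUnit

theorem X_mem_maximalIdeal :
    (PowerSeries.X : PowerSeries ℤ_[p]) ∈ IsLocalRing.maximalIdeal (PowerSeries ℤ_[p]) := by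
  rw [IsLocalRing.mem_maximalIdeal, mem_nonunits_iff, PowerSeries.isUnit_iff_constantCoeff]
  simp

theorem one_add_X_pow_sub_one_mem_maximalIdeal_pow (n : ℕ) :
    (1 + PowerSeries.X : PowerSeries ℤ_[p]) ^ p ^ n - 1 ∈
      IsLocalRing.maximalIdeal (PowerSeries ℤ_[p]) ^ (n + 1) := by
  induction n with
  | zero => simpa using X_mem_maximalIdeal
  | succ n ih =>
    obtain ⟨w, hw⟩ : ∃ w, w = (1 + PowerSeries.X : PowerSeries ℤ_[p]) ^ p ^ n - 1 := ⟨_, rfl⟩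
    rw [← hw] at ih
    obtain ⟨r, hr⟩ := exists_add_pow_prime_eq (Fact.out : p.Prime) (1 : PowerSeries ℤ_[p]) w
    have h1 : (1 + PowerSeries.X : PowerSeries ℤ_[p]) ^ p ^ (n + 1) - 1 =
        (w ^ (p - 1) + p * r) * w := by
      rw [pow_succ, pow_mul, show (1 + PowerSeries.X : PowerSeries ℤ_[p]) ^ p ^ n = 1 + w by
        rw [hw]; ring, hr, add_mul, ← pow_succ, Nat.sub_add_cancel (Fact.out : p.Prime).one_le]
      ring
    rw [h1, pow_succ' _ (n + 1)]
    refine Ideal.mul_mem_mul (Ideal.add_mem _ ?_ ?_) ih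
    · exact Ideal.pow_mem_of_mem _ (Ideal.pow_le_self (by simp) ih) _
        (Nat.sub_pos_of_lt (Fact.out : p.Prime).one_lt)
    · exact Ideal.mul_mem_right _ _ natCast_mem_maximalIdeal

theorem eq_zero_of_forall_one_add_X_pow_sub_one_dvd {f : PowerSeries ℤ_[p]}
    (hf : ∀ n : ℕ, (1 + PowerSeries.X : PowerSeries ℤ_[p]) ^ p ^ n - 1 ∣ f) : f = 0 := by
  have hmem : f ∈ ⨅ n : ℕ, IsLocalRing.maximalIdeal (PowerSeries ℤ_[p]) ^ n := by
    refine Ideal.mem_iInf.mpr fun n => Ideal.pow_le_pow_right (Nat.le_succ n) ?_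
    exact Ideal.mem_of_dvd _ (hf n) (one_add_X_pow_sub_one_mem_maximalIdeal_pow n)
  rwa [Ideal.iInf_pow_eq_bot_of_isLocalRing _ (IsLocalRing.maximalIdeal.isMaximal _).ne_top] at hmem

end IwasawaAlgebra

theorem mem_span_singleton_smul_top {A M : Type*} [CommRing A] [AddCommGroup M] [Module A M]
    {a : A} {m : M} :
    m ∈ (Ideal.span {a} • ⊤ : Submodule A M) ↔ ∃ y : M, a • y = m := by
  simp [Submodule.ideal_span_singleton_smul, Submodule.mem_smul_pointwise_iff_exists]

theorem map_mem_of_span_range_mkQ_eq_top (R : Type*) {A P M ι : Type*} [CommRing R] [CommRing A]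
    [Algebra R A] [AddCommGroup P] [Module A P] [Module R P] [IsScalarTower R A P]
    [AddCommGroup M] [Module A M] [Fintype ι] (f : P →ₗ[A] M) {N : Submodule A P}
    {T : Submodule A M} {w : ι → P}
    (hw : Submodule.span R (Set.range fun i => N.mkQ (w i)) = ⊤) (hwT : ∀ i, f (w i) ∈ T)
    (hN : ∀ z ∈ N, f z ∈ T) (z : P) : f z ∈ T := by
  have hz : N.mkQ z ∈ Submodule.span R (Set.range fun i => N.mkQ (w i)) := hw ▸ Submodule.mem_top
  obtain ⟨c, hc⟩ := (Submodule.mem_span_range_iff_exists_fun _).mp hz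
  have hsub : z - ∑ i, c i • w i ∈ N := by
    rw [← Submodule.ker_mkQ N, LinearMap.mem_ker, map_sub, ← hc, map_sum, sub_eq_zero]
    rfl
  change z ∈ (T.comap f).restrictScalars R
  rw [← sub_add_cancel z (∑ i, c i • w i)]
  exact Submodule.add_mem _ (hN _ hsub)
    (Submodule.sum_mem _ fun i _ => Submodule.smul_mem _ _ (hwT i))

section Presentation

variable {p : ℕ} [Fact p.Prime] {M : Type*} [AddCommGroup M] [Module (PowerSeries ℤ_[p]) M]
  [Module ℤ_[p] M] [IsScalarTower ℤ_[p] (PowerSeries ℤ_[p]) M]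

theorem finite_quotient_of_eq_X_pow_add [Module.Finite (PowerSeries ℤ_[p]) M]
    {g r : PowerSeries ℤ_[p]} {k : ℕ}
    (hg : g = PowerSeries.X ^ k + (p : PowerSeries ℤ_[p]) * r) :
    Module.Finite ℤ_[p] (M ⧸ (Ideal.span {g} • ⊤ : Submodule (PowerSeries ℤ_[p]) M)) := by
  obtain ⟨s, e, he⟩ := Module.Finite.exists_fin (R := PowerSeries ℤ_[p]) (M := M)
  let π := ((Ideal.span {g} • ⊤ : Submodule (PowerSeries ℤ_[p]) M).mkQ).restrictScalars ℤ_[p]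
  let b : Fin s × Fin k → M := fun ij => (PowerSeries.X : PowerSeries ℤ_[p]) ^ (ij.2 : ℕ) • e ij.1
  refine ⟨Submodule.fg_def.mpr ⟨Set.range (π ∘ b), Set.finite_range _, eq_top_iff.mpr ?_⟩⟩
  intro y _
  obtain ⟨m, rfl⟩ := Submodule.mkQ_surjective _ y
  change m ∈ (Submodule.span ℤ_[p] (Set.range (π ∘ b))).comap π
  have hm : m ∈ Submodule.span (PowerSeries ℤ_[p]) (Set.range e) := he ▸ Submodule.mem_top
  obtain ⟨c, rfl⟩ := (Submodule.mem_span_range_iff_exists_fun _).mp hm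
  refine Submodule.sum_mem _ fun j _ => smul_mem_of_forall_X_pow_smul_mem hg (fun m => ?_) ?_ _
  · have : π (g • m) = 0 :=
      (Submodule.Quotient.mk_eq_zero _).mpr (mem_span_singleton_smul_top.mpr ⟨m, rfl⟩)
    rw [Submodule.mem_comap, this]
    exact Submodule.zero_mem _
  · exact fun i => Submodule.subset_span ⟨(j, i), rfl⟩

theorem length_quotient_smulAddPowSMul_eq_finrank {g r : PowerSeries ℤ_[p]} {k : ℕ}
    (hg : g = PowerSeries.X ^ k + (p : PowerSeries ℤ_[p]) * r)
    [Module.Finite ℤ_[p] (M ⧸ (Ideal.span {g} • ⊤ : Submodule (PowerSeries ℤ_[p]) M))]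
    [Module.Free ℤ_[p] (M ⧸ (Ideal.span {g} • ⊤ : Submodule (PowerSeries ℤ_[p]) M))] :
    Module.length ℤ_[p]
      (M ⧸ smulAddPowSMul M (p : PowerSeries ℤ_[p]) PowerSeries.X k) =
    Module.finrank ℤ_[p] (M ⧸ (Ideal.span {g} • ⊤ : Submodule (PowerSeries ℤ_[p]) M)) := by
  have hle : (Ideal.span {g} • ⊤ : Submodule (PowerSeries ℤ_[p]) M) ≤
      smulAddPowSMul M (p : PowerSeries ℤ_[p]) PowerSeries.X k := by
    intro m hm
    obtain ⟨y, rfl⟩ := mem_span_singleton_smul_top.mp hm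
    exact mem_smulAddPowSMul.mpr ⟨r • y, y, by
      rw [hg]
      rw [add_smul, mul_smul, add_comm]⟩
  refine length_eq_finrank_of_surjective_of_ker (p : ℤ_[p])
    (PadicInt.maximalIdeal_eq_span_p (p := p) ▸ IsLocalRing.maximalIdeal.isMaximal _)
    ((Submodule.factor hle).restrictScalars ℤ_[p]) (Submodule.factor_surjective hle) fun y => ?_
  obtain ⟨m, rfl⟩ := Submodule.mkQ_surjective _ y
  change Submodule.Quotient.mk m = 0 ↔ _
  rw [Submodule.Quotient.mk_eq_zero, mem_smulAddPowSMul]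
  constructor
  · rintro ⟨a, b, rfl⟩
    refine ⟨Submodule.Quotient.mk (a - r • b), ?_⟩
    rw [Nat.cast_smul_eq_nsmul, ← Submodule.Quotient.mk_smul]
    refine (Submodule.Quotient.eq _).mpr (mem_span_singleton_smul_top.mpr ⟨-b, ?_⟩)
    rw [hg, ← Nat.cast_smul_eq_nsmul (PowerSeries ℤ_[p])]
    simp only [add_smul, mul_smul, smul_neg, smul_sub]
    abel
  · rintro ⟨y, hy⟩
    obtain ⟨y, rfl⟩ := Submodule.mkQ_surjective _ y
    rw [Nat.cast_smul_eq_nsmul, ← map_nsmul] at hy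
    obtain ⟨z, hz⟩ := mem_span_singleton_smul_top.mp ((Submodule.Quotient.eq _).mp hy)
    rw [← Nat.cast_smul_eq_nsmul (PowerSeries ℤ_[p])] at hz
    refine ⟨y - r • z, -z, ?_⟩
    rw [← sub_sub_cancel ((p : PowerSeries ℤ_[p]) • y) m, ← hz, hg]
    simp only [add_smul, mul_smul, smul_neg, smul_sub]
    abel

theorem exists_generators_of_length [Module.Finite (PowerSeries ℤ_[p]) M] {d δ : ℕ}
    (htf : ∀ a b : M, (p : PowerSeries ℤ_[p]) • a = (PowerSeries.X : PowerSeries ℤ_[p]) • b →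
      ∃ w : M, (PowerSeries.X : PowerSeries ℤ_[p]) • w = a)
    (h0 : Module.length ℤ_[p]
      (M ⧸ gradedKernel M (p : PowerSeries ℤ_[p]) PowerSeries.X 0) = (d + δ : ℕ))
    (h1 : Module.length ℤ_[p]
      (M ⧸ gradedKernel M (p : PowerSeries ℤ_[p]) PowerSeries.X 1) = d) :
    ∃ (v : Fin d → M) (u : Fin δ → M),
      (∀ j, (PowerSeries.X : PowerSeries ℤ_[p]) • u j = 0) ∧
      Submodule.span (PowerSeries ℤ_[p]) (Set.range v ∪ Set.range u) = ⊤ := by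
  set N₀ := gradedKernel M (p : PowerSeries ℤ_[p]) PowerSeries.X 0 with hN₀
  set N₁ := gradedKernel M (p : PowerSeries ℤ_[p]) PowerSeries.X 1
  have hle : N₀ ≤ N₁ := gradedKernel_mono zero_le_one
  have hlen : Module.length ℤ_[p] (N₁ ⧸ N₀.comap N₁.subtype) = δ := by
    have h := length_quotient_eq_add ℤ_[p] N₁.subtype hle fun m =>
      ⟨fun hm => ⟨⟨m, hm⟩, by simp⟩, fun ⟨z, hz⟩ => by
        simpa using N₁.sub_mem z.2 (hle hz)⟩
    rw [h0, h1, add_comm d δ, Nat.cast_add] at h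
    exact ((ENat.add_left_injective_of_ne_top (ENat.natCast_ne_top d)) h).symm
  obtain ⟨v', hv'⟩ := exists_fin_span_eq_top_of_length_le d _ h1.le
  obtain ⟨u', hu'⟩ := exists_fin_span_eq_top_of_length_le δ _ hlen.le
  choose v hv using fun i => N₁.mkQ_surjective (v' i)
  choose u₀ hu₀ using fun i => (N₀.comap N₁.subtype).mkQ_surjective (u' i)
  have hlift : ∀ j, ∃ u : M, (PowerSeries.X : PowerSeries ℤ_[p]) • u = 0 ∧ (u₀ j : M) - u ∈ N₀ := by
    intro j
    obtain ⟨a, b, hab⟩ := mem_gradedKernel.mp (u₀ j).2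
    obtain ⟨w, rfl⟩ := htf a ((u₀ j : M) - (PowerSeries.X : PowerSeries ℤ_[p]) • b) (by
      rw [smul_sub, smul_smul, ← pow_two, eq_sub_iff_add_eq]
      simpa using hab)
    refine ⟨u₀ j - (PowerSeries.X : PowerSeries ℤ_[p]) • b - (p : PowerSeries ℤ_[p]) • w, ?_, ?_⟩
    · rw [smul_sub, smul_sub, sub_sub, sub_eq_zero]
      rw [pow_one] at hab
      rw [← hab]
      simp only [pow_succ, pow_zero, one_mul, mul_smul]
      rw [smul_comm (PowerSeries.X : PowerSeries ℤ_[p]) (p : PowerSeries ℤ_[p]) w, add_comm]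
    · rw [hN₀, gradedKernel_zero, mem_smulAddPowSMul]
      exact ⟨w, b, by
        rw [pow_one]
        abel⟩
  choose u hXu hu using hlift
  refine ⟨v, u, hXu, ?_⟩
  set S := Submodule.span (PowerSeries ℤ_[p]) (Set.range v ∪ Set.range u)
  have hu₀S : ∀ j, (u₀ j : M) ∈ S ⊔ N₀ := fun j => by
    rw [← add_sub_cancel (u j) (u₀ j : M)]
    exact Submodule.add_mem_sup (Submodule.subset_span (Or.inr ⟨j, rfl⟩)) (hu j)
  have hN₁S : ∀ z : N₁, (z : M) ∈ S ⊔ N₀ :=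
    map_mem_of_span_range_mkQ_eq_top ℤ_[p] N₁.subtype
      (N := N₀.comap N₁.subtype) (by simpa only [hu₀] using hu') hu₀S
      fun z hz => Submodule.mem_sup_right hz
  have htop : (⊤ : Submodule (PowerSeries ℤ_[p]) M) ≤ S ⊔ N₀ := fun m _ =>
    map_mem_of_span_range_mkQ_eq_top ℤ_[p] LinearMap.id (N := N₁) (w := v)
      (by simpa only [hv] using hv')
      (fun i => Submodule.mem_sup_left (Submodule.subset_span (Or.inl ⟨i, rfl⟩)))
      (fun z hz => hN₁S ⟨z, hz⟩) m
  have hN₀_le : N₀ ≤ IsLocalRing.maximalIdeal (PowerSeries ℤ_[p]) •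
      (⊤ : Submodule (PowerSeries ℤ_[p]) M) := by
    rw [hN₀, gradedKernel_zero]
    intro m hm
    obtain ⟨a, b, rfl⟩ := mem_smulAddPowSMul.mp hm
    rw [pow_one]
    exact Submodule.add_mem _ (Submodule.smul_mem_smul natCast_mem_maximalIdeal Submodule.mem_top)
      (Submodule.smul_mem_smul X_mem_maximalIdeal Submodule.mem_top)
  exact top_le_iff.mp (Submodule.le_of_le_smul_of_le_jacobson_bot Module.Finite.fg_top
    (IsLocalRing.maximalIdeal_le_jacobson _) (htop.trans (sup_le_sup_left hN₀_le _)))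

end Presentation

section Presentation

variable {p : ℕ} [Fact p.Prime] {M : Type*} [AddCommGroup M] [Module (PowerSeries ℤ_[p]) M]
  {d δ : ℕ}

/-- The map `Λ ^ d × (Λ / X) ^ δ → M` sending the standard generators to the `v i` and the `u j`,
where the `u j` are killed by `X`. -/
noncomputable def presentationMap (v : Fin d → M) (u : Fin δ → M)
    (hu : ∀ j, (PowerSeries.X : PowerSeries ℤ_[p]) • u j = 0) :
    (Fin d → PowerSeries ℤ_[p]) × (Fin δ → PowerSeries ℤ_[p] ⧸
      (Ideal.span {(PowerSeries.X : PowerSeries ℤ_[p])} : Ideal (PowerSeries ℤ_[p])))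
      →ₗ[PowerSeries ℤ_[p]] M :=
  (Fintype.linearCombination (PowerSeries ℤ_[p]) v).coprod
    (∑ j, (Submodule.liftQ (Ideal.span {(PowerSeries.X : PowerSeries ℤ_[p])})
      (LinearMap.toSpanSingleton (PowerSeries ℤ_[p]) M (u j))
      ((Ideal.span_singleton_le_iff_mem _).mpr (hu j))) ∘ₗ LinearMap.proj j)

variable {v : Fin d → M} {u : Fin δ → M}
  {hu : ∀ j, (PowerSeries.X : PowerSeries ℤ_[p]) • u j = 0}

theorem presentationMap_apply_mk (f : Fin d → PowerSeries ℤ_[p]) (h : Fin δ → PowerSeries ℤ_[p]) :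
    presentationMap v u hu (f, fun j => Submodule.Quotient.mk (h j)) =
      ∑ i, f i • v i + ∑ j, h j • u j := by
  simp only [presentationMap, LinearMap.coprod_apply, Fintype.linearCombination_apply,
    LinearMap.sum_apply]
  rfl

theorem presentationMap_surjective
    (hspan : Submodule.span (PowerSeries ℤ_[p]) (Set.range v ∪ Set.range u) = ⊤) :
    Function.Surjective (presentationMap v u hu) := by
  rw [← LinearMap.range_eq_top, eq_top_iff, ← hspan, Submodule.span_le, Set.union_subset_iff]
  constructor
  · rintro _ ⟨i, rfl⟩
    refine ⟨(Pi.single i 1, fun _ => Submodule.Quotient.mk 0), ?_⟩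
    rw [presentationMap_apply_mk _ fun _ => 0]
    simp [Pi.single_apply]
  · rintro _ ⟨j, rfl⟩
    refine ⟨(0, fun j' => Submodule.Quotient.mk ((Pi.single j 1 : Fin δ → PowerSeries ℤ_[p]) j')),
      ?_⟩
    rw [presentationMap_apply_mk _ (Pi.single j 1)]
    simp [Pi.single_apply]

variable [Module ℤ_[p] M] [IsScalarTower ℤ_[p] (PowerSeries ℤ_[p]) M]

variable (v u) in
/-- The elements `X ^ i v j`, for `i < k`, and `u j` of `M / g M`. -/
noncomputable def quotientGenerators (g : PowerSeries ℤ_[p]) (k : ℕ) :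
    (Fin d × Fin k) ⊕ Fin δ → M ⧸ (Ideal.span {g} • ⊤ : Submodule (PowerSeries ℤ_[p]) M) :=
  Sum.elim (fun ji => Submodule.Quotient.mk
    ((PowerSeries.X : PowerSeries ℤ_[p]) ^ (ji.2 : ℕ) • v ji.1)) fun j => Submodule.Quotient.mk (u j)

theorem exists_mk_presentationMap_eq_sum {g r : PowerSeries ℤ_[p]} {k : ℕ}
    (hg : g = PowerSeries.X ^ k + (p : PowerSeries ℤ_[p]) * r)
    (z : (Fin d → PowerSeries ℤ_[p]) × (Fin δ → PowerSeries ℤ_[p] ⧸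
      (Ideal.span {(PowerSeries.X : PowerSeries ℤ_[p])} : Ideal (PowerSeries ℤ_[p])))) :
    ∃ s : (Fin d × Fin k) ⊕ Fin δ → ℤ_[p],
      (s = 0 → (∀ i, g ∣ z.1 i) ∧ z.2 = 0) ∧
      Submodule.Quotient.mk (presentationMap v u hu z) =
        ∑ x, s x • quotientGenerators v u g k x := by
  obtain ⟨f, h⟩ := z
  choose q c hqc using fun i => exists_eq_mul_add_sum_of_eq_X_pow_add hg (f i)
  have hconst : ∀ j, ∃ a : ℤ_[p], h j = Submodule.Quotient.mk (PowerSeries.C a) := fun j => by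
    obtain ⟨y, hy⟩ := Submodule.mkQ_surjective _ (h j)
    refine ⟨PowerSeries.constantCoeff y, hy ▸ (Submodule.Quotient.eq _).mpr ?_⟩
    rw [PowerSeries.sub_const_eq_X_mul_shift]
    exact Ideal.mul_mem_right _ _ (Ideal.mem_span_singleton_self _)
  choose a ha using hconst
  obtain rfl : h = fun j => Submodule.Quotient.mk (PowerSeries.C (a j)) := funext ha
  refine ⟨Sum.elim (fun ji => c ji.1 ji.2) a, fun hs => ⟨fun i => ?_, ?_⟩, ?_⟩
  · have hc : ∀ l, c i l = 0 := fun l => congrFun hs (Sum.inl (i, l))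
    exact ⟨q i, by simpa [hc] using hqc i⟩
  · have h0 : ∀ j, a j = 0 := fun j => congrFun hs (Sum.inr j)
    ext j
    simp [h0]
  · have hfv : ∀ i, f i • v i = g • q i • v i +
        ∑ l : Fin k, c i l • (PowerSeries.X : PowerSeries ℤ_[p]) ^ (l : ℕ) • v i := fun i => by
      conv_lhs => rw [hqc i]
      simp only [add_smul, mul_smul, Finset.sum_smul, smul_assoc]
    have hau : ∀ j, PowerSeries.C (a j) • u j = a j • u j := fun j => by
      rw [← algebraMap_smul (PowerSeries ℤ_[p]) (a j) (u j)]
      rfl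
    have hsum : (∑ x, (Sum.elim (fun ji => c ji.1 ji.2) a : (Fin d × Fin k) ⊕ Fin δ → ℤ_[p]) x •
        quotientGenerators v u g k x) = Submodule.Quotient.mk
          ((∑ i, ∑ l : Fin k, c i l • (PowerSeries.X : PowerSeries ℤ_[p]) ^ (l : ℕ) • v i) +
            ∑ j, a j • u j) := by
      rw [Fintype.sum_sum_type, Fintype.sum_prod_type]
      simp only [quotientGenerators, Sum.elim_inl, Sum.elim_inr, ← Submodule.mkQ_apply, map_add,
        map_sum]
      rfl
    rw [hsum, presentationMap_apply_mk]
    refine (Submodule.Quotient.eq _).mpr (mem_span_singleton_smul_top.mpr ⟨∑ i, q i • v i, ?_⟩)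
    simp only [hfv, hau, Finset.sum_add_distrib, Finset.smul_sum]
    abel

theorem presentationMap_injective
    (hspan : Submodule.span (PowerSeries ℤ_[p]) (Set.range v ∪ Set.range u) = ⊤)
    (hrank : ∀ n : ℕ, Module.finrank ℤ_[p]
      (M ⧸ (Ideal.span {(1 + PowerSeries.X : PowerSeries ℤ_[p]) ^ p ^ n - 1} • ⊤ :
        Submodule (PowerSeries ℤ_[p]) M)) = d * p ^ n + δ) :
    Function.Injective (presentationMap v u hu) := by
  rw [injective_iff_map_eq_zero]
  intro z hz
  have hn : ∀ n : ℕ, (∀ i, (1 + PowerSeries.X : PowerSeries ℤ_[p]) ^ p ^ n - 1 ∣ z.1 i) ∧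
      z.2 = 0 := by
    intro n
    obtain ⟨r, hr⟩ := exists_one_add_X_pow_sub_one_eq (p := p) n
    set g := (1 + PowerSeries.X : PowerSeries ℤ_[p]) ^ p ^ n - 1
    have hindep : LinearIndependent ℤ_[p] (quotientGenerators v u g (p ^ n)) := by
      refine linearIndependent_of_top_le_span_of_card_eq_finrank ?_ ?_
      · intro y _
        obtain ⟨m, rfl⟩ := Submodule.mkQ_surjective _ y
        obtain ⟨w, rfl⟩ := presentationMap_surjective (hu := hu) hspan m
        obtain ⟨s, -, hs⟩ := exists_mk_presentationMap_eq_sum (v := v) (hu := hu) hr w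
        rw [Submodule.mkQ_apply, hs]
        exact (Submodule.mem_span_range_iff_exists_fun _).mpr ⟨s, rfl⟩
      · rw [hrank n]
        simp
    obtain ⟨s, hs0, hs⟩ := exists_mk_presentationMap_eq_sum (v := v) (hu := hu) hr z
    rw [hz, Submodule.Quotient.mk_zero] at hs
    exact hs0 (funext (Fintype.linearIndependent_iff.mp hindep s hs.symm))
  exact Prod.ext (funext fun i => eq_zero_of_forall_one_add_X_pow_sub_one_dvd fun n => (hn n).1 i)
    (hn 0).2

theorem exists_X_smul_eq_of_free_quotient
    [Module.Free ℤ_[p] (M ⧸ (Ideal.span {(PowerSeries.X : PowerSeries ℤ_[p])} • ⊤ :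
      Submodule (PowerSeries ℤ_[p]) M))] {a b : M}
    (hab : (p : PowerSeries ℤ_[p]) • a = (PowerSeries.X : PowerSeries ℤ_[p]) • b) :
    ∃ w : M, (PowerSeries.X : PowerSeries ℤ_[p]) • w = a := by
  rw [← mem_span_singleton_smul_top, ← Submodule.Quotient.mk_eq_zero]
  have h : (p : ℤ_[p]) • (Submodule.Quotient.mk a :
      M ⧸ (Ideal.span {(PowerSeries.X : PowerSeries ℤ_[p])} • ⊤ :
        Submodule (PowerSeries ℤ_[p]) M)) = 0 := by
    rw [Nat.cast_smul_eq_nsmul, ← Submodule.Quotient.mk_smul, Submodule.Quotient.mk_eq_zero,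
      ← Nat.cast_smul_eq_nsmul (PowerSeries ℤ_[p]), hab]
    exact mem_span_singleton_smul_top.mpr ⟨b, rfl⟩
  exact (smul_eq_zero.mp h).resolve_left PadicInt.prime_p.ne_zero

end Presentation

/-- Let `d ≥ 0`, `δ ∈ {0, 2}`, and let `M` be a finitely generated `Λ`-module
(`Λ = ℤ_p[[X]]`) such that for every `n ≥ 0` the quotient `M/ω_n M` is a free
`ℤ_p`-module of rank `d·p^n + δ`, where `ω_n = (1+X)^{p^n} − 1`. Then
`M ≅ Λ^d ⊕ (Λ/XΛ)^δ` as `Λ`-modules. -/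
theorem stmt16 (p : ℕ) [Fact p.Prime] (d δ : ℕ) (hδ : δ = 0 ∨ δ = 2)
    (M : Type*) [AddCommGroup M] [Module (PowerSeries ℤ_[p]) M]
    [Module.Finite (PowerSeries ℤ_[p]) M]
    [Module ℤ_[p] M] [IsScalarTower ℤ_[p] (PowerSeries ℤ_[p]) M]
    (hfree : ∀ n : ℕ, Module.Free ℤ_[p]
      (M ⧸ (Ideal.span {(1 + PowerSeries.X : PowerSeries ℤ_[p]) ^ p ^ n - 1} • ⊤ :
        Submodule (PowerSeries ℤ_[p]) M)))
    (hrank : ∀ n : ℕ, Module.finrank ℤ_[p]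
      (M ⧸ (Ideal.span {(1 + PowerSeries.X : PowerSeries ℤ_[p]) ^ p ^ n - 1} • ⊤ :
        Submodule (PowerSeries ℤ_[p]) M)) = d * p ^ n + δ) :
    Nonempty (M ≃ₗ[PowerSeries ℤ_[p]]
      (Fin d → PowerSeries ℤ_[p]) ×
      (Fin δ → PowerSeries ℤ_[p] ⧸
        (Ideal.span {(PowerSeries.X : PowerSeries ℤ_[p])} : Ideal (PowerSeries ℤ_[p])))) := by
  have hfin : ∀ n : ℕ, Module.Finite ℤ_[p]
      (M ⧸ (Ideal.span {(1 + PowerSeries.X : PowerSeries ℤ_[p]) ^ p ^ n - 1} • ⊤ :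
        Submodule (PowerSeries ℤ_[p]) M)) := fun n =>
    finite_quotient_of_eq_X_pow_add (exists_one_add_X_pow_sub_one_eq n).choose_spec
  have hlen : ∀ n : ℕ, Module.length ℤ_[p]
      (M ⧸ smulAddPowSMul M (p : PowerSeries ℤ_[p]) PowerSeries.X (p ^ n)) =
        (d * p ^ n + δ : ℕ) := fun n => by
    rw [length_quotient_smulAddPowSMul_eq_finrank (exists_one_add_X_pow_sub_one_eq n).choose_spec,
      hrank]
  obtain ⟨h0, h1⟩ := length_quotient_gradedKernel ℤ_[p] (Fact.out : p.Prime).two_le hlen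
  have hfree0 := hfree 0
  rw [pow_zero, pow_one, add_sub_cancel_left] at hfree0
  obtain ⟨v, u, hu, hspan⟩ := exists_generators_of_length
    (fun _ _ => exists_X_smul_eq_of_free_quotient) h0 h1
  exact ⟨(LinearEquiv.ofBijective (presentationMap v u hu)
    ⟨presentationMap_injective hspan hrank, presentationMap_surjective hspan⟩).symm⟩
end
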